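/- Let {P_n}_{n≥0} be a family of monic orthogonal polynomials on the lattice ±q^ℤ with weight w, with norms γ_n and recurrence coefficients α_n = γ_n/γ_{n−1}. Then: (a) there exist an even entire function a : ℂ → ℂ with a(0) = 1 satisfying a(q^{−2}z) + (q^{−3} z² (1+q^{−1}) − (1+q^{−1})) a(q^{−1}z) + q^{−1}(1 + q^{−4} z⁴) a(z) = 0 for all z ∈ ℂ, a nonzero real constant C, and for every compact set K ⊂ ℂ a constant M_K > 0, such that for all even n, sup_{z ∈ K} | (−1)^{n/2} q^{(n/2)(n/2−1)} P_n(z) − C a(z) | ≤ M_K q^{n/4}; (b) there exists a function a_∞, analytic on ℂ ∖ {0} and given by an everywhere-convergent even power series a_∞(t) = Σ_{j=0}^∞ a_{2j} t^{−2j} with a_0 = 1, satisfying q⁷ t^{−4} a_∞(q^{−2} t) − (1 − q²(q+1) t^{−2}) a_∞(q^{−1} t) + a_∞(t) = 0 for all t ≠ 0, such that for each fixed t ∈ ℂ ∖ {0} there is a constant M_t > 0 with | q^{n²/2} t^{−n} P_n(t q^{−n/2}) − a_∞(t) | ≤ M_t q^{n/4} for all sufficiently large even n. -/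

import Mathlib

open Polynomial Topology

/-- The weight `w(x) = ∏_{j=0}^∞ (1 + x⁴ q^{4j})⁻¹`. -/
noncomputable def qweight (q x : ℝ) : ℝ := ∏' j : ℕ, (1 + x ^ 4 * q ^ (4 * j))⁻¹

/-- A family of monic orthogonal polynomials on the lattice `±c qᶻ` with weight `qweight q`. -/
structure MonicOrthFamily (q c : ℝ) where
  P : ℕ → Polynomial ℝ
  γ : ℕ → ℝ
  monic : ∀ n, (P n).Monic
  deg : ∀ n, (P n).natDegree = n
  γ_pos : ∀ n, 0 < γ n
  abs_summable : ∀ n m : ℕ, Summable (fun k : ℤ =>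
    |((P n).eval (c * q ^ k) * (P m).eval (c * q ^ k) * qweight q (c * q ^ k)
      + (P n).eval (-(c * q ^ k)) * (P m).eval (-(c * q ^ k)) * qweight q (-(c * q ^ k)))
        * q ^ k|)
  orth : ∀ n m : ℕ,
    (∑' k : ℤ, ((P n).eval (c * q ^ k) * (P m).eval (c * q ^ k) * qweight q (c * q ^ k)
      + (P n).eval (-(c * q ^ k)) * (P m).eval (-(c * q ^ k)) * qweight q (-(c * q ^ k)))
        * q ^ k)
      = if n = m then γ n else 0

/-- Monic orthogonal polynomials for a reflection-invariant functional `L` on real polynomials that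
obeys the scaling law `L[p(qx)(1 + x⁴)] = q⁻¹ L[p]`. -/
structure QFreudSystem (q : ℝ) where
  L : ℝ[X] →ₗ[ℝ] ℝ
  P : ℕ → ℝ[X]
  γ : ℕ → ℝ
  monic : ∀ n, (P n).Monic
  deg : ∀ n, (P n).natDegree = n
  γ_pos : ∀ n, 0 < γ n
  orth : ∀ n m, L (P n * P m) = if n = m then γ n else 0
  map_reflect : ∀ p : ℝ[X], L (p.comp (-X)) = L p
  map_scale : ∀ p : ℝ[X], L (p.comp (C q * X) * (1 + X ^ 4)) = q⁻¹ * L p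

namespace QFreudSystem

variable {q : ℝ} (S : QFreudSystem q)

/-- The recurrence coefficients `γ_n / γ_{n-1}`. -/
noncomputable def α (n : ℕ) : ℝ := S.γ n / S.γ (n - 1)

lemma α_pos (n : ℕ) : 0 < S.α n := div_pos (S.γ_pos _) (S.γ_pos _)

lemma γ_succ (n : ℕ) : S.γ (n + 1) = S.α (n + 1) * S.γ n := by
  have := (S.γ_pos n).ne'
  simp only [α, Nat.add_sub_cancel]
  field_simp

lemma coeff_self (n : ℕ) : (S.P n).coeff n = 1 := by
  have := S.monic n
  rw [Monic, leadingCoeff, S.deg] at this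
  exact this

lemma map_mul_eq_zero (d : ℕ) : ∀ (p : ℝ[X]) (n : ℕ), p.degree < d → d ≤ n →
    L S (p * S.P n) = 0 := by
  induction d with
  | zero =>
    intro p n hp _
    have : p = 0 := by
      rw [← degree_eq_bot]
      simpa using hp
    simp [this]
  | succ d ih =>
    intro p n hp hn
    have h1 : (p - C (p.coeff d) * S.P d).degree < d := by
      rw [degree_lt_iff_coeff_zero] at hp ⊢
      intro m hm
      rcases hm.eq_or_lt with rfl | hm
      · simp [S.coeff_self]
      · have : (S.P d).coeff m = 0 := coeff_eq_zero_of_natDegree_lt (by rw [S.deg]; exact hm)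
        simp [hp m hm, this]
    have h2 := ih _ n h1 (by omega)
    rw [sub_mul, map_sub, mul_assoc, ← smul_eq_C_mul, map_smul, S.orth, if_neg (by omega)] at h2
    simpa using h2

lemma map_mul_of_natDegree_le {p : ℝ[X]} {n : ℕ} (hp : p.natDegree ≤ n) :
    S.L (p * S.P n) = p.coeff n * S.γ n := by
  have h1 : (p - C (p.coeff n) * S.P n).degree < n := by
    rw [degree_lt_iff_coeff_zero]
    intro m hm
    rcases hm.eq_or_lt with rfl | hm
    · simp [S.coeff_self]
    · have : (S.P n).coeff m = 0 := coeff_eq_zero_of_natDegree_lt (by rw [S.deg]; exact hm)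
      simp [coeff_eq_zero_of_natDegree_lt (hp.trans_lt hm), this]
  have h2 := S.map_mul_eq_zero n _ n h1 le_rfl
  rw [sub_mul, map_sub, mul_assoc, ← smul_eq_C_mul, map_smul, S.orth, if_pos rfl] at h2
  simp only [smul_eq_mul] at h2
  linarith

lemma map_mul_of_natDegree_lt {p : ℝ[X]} {n : ℕ} (hp : p.natDegree < n) :
    S.L (p * S.P n) = 0 := by
  rw [S.map_mul_of_natDegree_le hp.le, coeff_eq_zero_of_natDegree_lt hp, zero_mul]

lemma eq_zero_of_map_mul {r : ℝ[X]} {N : ℕ} (hr : r.natDegree < N)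
    (h : ∀ k < N, S.L (r * S.P k) = 0) : r = 0 := by
  have h1 := S.map_mul_of_natDegree_le (le_refl r.natDegree)
  rw [h _ hr] at h1
  have h2 : r.leadingCoeff = 0 := by
    rcases mul_eq_zero.mp h1.symm with h | h
    · exact h
    · exact absurd h (S.γ_pos _).ne'
  exact leadingCoeff_eq_zero.mp h2

lemma natDegree_comp_neg_X (p : ℝ[X]) : (p.comp (-X)).natDegree = p.natDegree := by
  rw [natDegree_comp, natDegree_neg, natDegree_X, mul_one]

lemma coeff_comp_neg_X (p : ℝ[X]) (k : ℕ) : (p.comp (-X)).coeff k = (-1) ^ k * p.coeff k := by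
  have h : (-X : ℝ[X]) = C (-1) * X := by simp
  rw [h, comp_C_mul_X_coeff, mul_comm]

lemma P_comp_neg (n : ℕ) : (S.P n).comp (-X) = (-1) ^ n * S.P n := by
  have h2 : ((-1 : ℝ[X]) ^ n) = C ((-1) ^ n) := by simp
  rw [← sub_eq_zero, h2]
  have hle : ((S.P n).comp (-X) - C ((-1) ^ n) * S.P n).natDegree < n + 1 := by
    refine Nat.lt_succ_of_le ((natDegree_sub_le _ _).trans (max_le ?_ ?_))
    · rw [natDegree_comp_neg_X, S.deg]
    · exact (natDegree_C_mul_le _ _).trans (S.deg n).le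
  refine S.eq_zero_of_map_mul hle fun k hk => ?_
  have h3 : S.L ((S.P n).comp (-X) * S.P k) = S.L ((S.P k).comp (-X) * S.P n) := by
    rw [← S.map_reflect, mul_comp, comp_neg_X_comp_neg_X, mul_comm]
  rw [sub_mul, map_sub, h3, mul_assoc, ← smul_eq_C_mul, map_smul, S.orth, smul_eq_mul]
  rcases (Nat.lt_succ_iff.mp hk).eq_or_lt with rfl | hk
  · rw [S.map_mul_of_natDegree_le (by rw [natDegree_comp_neg_X, S.deg]), coeff_comp_neg_X,
      S.coeff_self]
    simp
  · rw [S.map_mul_of_natDegree_lt (by rw [natDegree_comp_neg_X, S.deg]; exact hk),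
      if_neg (by omega)]
    simp

lemma map_mul_eq_zero_of_odd {p : ℝ[X]} {m k : ℕ} (hp : p.comp (-X) = (-1) ^ m * p)
    (h : Odd (m + k)) : S.L (p * S.P k) = 0 := by
  have h1 := S.map_reflect (p * S.P k)
  rw [mul_comp, hp, S.P_comp_neg] at h1
  have h2 : (-1 : ℝ[X]) ^ m * p * ((-1) ^ k * S.P k) = - (p * S.P k) := by
    rw [show (-1 : ℝ[X]) ^ m * p * ((-1) ^ k * S.P k) = (-1) ^ (m + k) * (p * S.P k) by ring,
      h.neg_one_pow]
    ring
  rw [h2, map_neg] at h1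
  linarith

lemma P_zero : S.P 0 = 1 := (S.monic 0).natDegree_eq_zero.mp (S.deg 0)

lemma P_one : S.P 1 = X := by
  have h := S.P_comp_neg 1
  have h1 : (S.P 1).coeff 0 = 0 := by
    have := congrArg (fun p => p.coeff 0) h
    simp only [coeff_comp_neg_X] at this
    simp at this
    linarith
  ext k
  rcases k with _ | _ | k
  · simp [h1]
  · simp [S.coeff_self 1]
  · rw [coeff_eq_zero_of_natDegree_lt (by rw [S.deg]; omega), coeff_X_of_ne_one (by omega)]

lemma map_C_mul_mul (c : ℝ) (j k : ℕ) :
    S.L (C c * S.P j * S.P k) = c * (if j = k then S.γ j else 0) := by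
  rw [mul_assoc, ← smul_eq_C_mul, map_smul, S.orth, smul_eq_mul]

lemma natDegree_X_mul_P (n : ℕ) : (X * S.P n).natDegree = n + 1 := by
  rw [natDegree_X_mul (S.monic n).ne_zero, S.deg]

/-- The three-term recurrence. -/
lemma P_add_two (n : ℕ) : S.P (n + 2) = X * S.P (n + 1) - C (S.α (n + 1)) * S.P n := by
  rw [← sub_eq_zero]
  have hle : (S.P (n + 2) - (X * S.P (n + 1) - C (S.α (n + 1)) * S.P n)).natDegree ≤ n + 2 := by
    refine (natDegree_sub_le _ _).trans
      (max_le (S.deg _).le ((natDegree_sub_le _ _).trans (max_le ?_ ?_)))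
    · rw [S.natDegree_X_mul_P]
    · exact (natDegree_C_mul_le _ _).trans (by rw [S.deg]; omega)
  refine S.eq_zero_of_map_mul (N := n + 3) (by omega) fun k hk => ?_
  rw [sub_mul, sub_mul, map_sub, map_sub, mul_assoc (C _), ← smul_eq_C_mul, map_smul, S.orth,
    S.orth, smul_eq_mul]
  have hpar : (X * S.P (n + 1)).comp (-X) = (-1) ^ (n + 2) * (X * S.P (n + 1)) := by
    rw [mul_comp, S.P_comp_neg, X_comp]; ring
  have hcom : S.L (X * S.P (n + 1) * S.P k) = S.L ((X * S.P k) * S.P (n + 1)) := by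
    congr 1; ring
  rcases Nat.lt_trichotomy k n with h | rfl | h
  · rw [if_neg (by omega), if_neg (by omega), hcom,
      S.map_mul_of_natDegree_lt (by rw [S.natDegree_X_mul_P]; omega)]
    ring
  · rw [if_neg (by omega), if_pos rfl, hcom,
      S.map_mul_of_natDegree_le (S.natDegree_X_mul_P _).le, coeff_X_mul, S.coeff_self, S.γ_succ]
    ring
  · obtain rfl | rfl : k = n + 1 ∨ k = n + 2 := by omega
    · rw [if_neg (by omega), if_neg (by omega), S.map_mul_eq_zero_of_odd hpar ⟨n + 1, by ring⟩]
      ring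
    · rw [if_pos rfl, if_neg (by omega),
        S.map_mul_of_natDegree_le (S.natDegree_X_mul_P _).le, coeff_X_mul, S.coeff_self]
      ring

/-- The functional form of the `q`-scaling of the weight: `p ↦ (1 + x⁴) p(qx)` is `q⁻¹` times the
adjoint of `r ↦ r(x/q)`. -/
lemma map_scale_mul (hq : q ≠ 0) (p r : ℝ[X]) :
    S.L (p.comp (C q * X) * (1 + X ^ 4) * r) = q⁻¹ * S.L (p * r.comp (C q⁻¹ * X)) := by
  rw [← S.map_scale, mul_comp, comp_assoc]
  congr 1
  have : (C q⁻¹ * X : ℝ[X]).comp (C q * X) = X := by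
    rw [mul_comp, C_comp, X_comp, ← mul_assoc, ← C_mul, inv_mul_cancel₀ hq, C_1, one_mul]
  rw [this, comp_X]
  ring

lemma natDegree_comp_C_mul_X_le (p : ℝ[X]) (c : ℝ) : (p.comp (C c * X)).natDegree ≤ p.natDegree :=
  natDegree_comp_le.trans
    ((Nat.mul_le_mul_left _ ((natDegree_C_mul_le _ _).trans natDegree_X_le)).trans (by simp))

lemma natDegree_dilate_le (n : ℕ) :
    ((S.P n).comp (C q * X) * (1 + X ^ 4)).natDegree ≤ n + 4 := by
  refine natDegree_mul_le_of_le ((natDegree_comp_C_mul_X_le _ _).trans (S.deg n).le) ?_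
  compute_degree

lemma coeff_dilate (n k : ℕ) : ((S.P n).comp (C q * X) * (1 + X ^ 4)).coeff (k + 4) =
    (S.P n).coeff (k + 4) * q ^ (k + 4) + (S.P n).coeff k * q ^ k := by
  rw [mul_add, mul_one, coeff_add, coeff_mul_X_pow, comp_C_mul_X_coeff, comp_C_mul_X_coeff]

lemma coeff_dilate_of_lt (n k : ℕ) (hk : k < 4) :
    ((S.P n).comp (C q * X) * (1 + X ^ 4)).coeff k = (S.P n).coeff k * q ^ k := by
  rw [mul_add, mul_one, coeff_add, coeff_mul_X_pow', comp_C_mul_X_coeff, if_neg (by omega),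
    add_zero]

lemma dilate_comp_neg (n : ℕ) : ((S.P n).comp (C q * X) * (1 + X ^ 4)).comp (-X) =
    (-1) ^ n * ((S.P n).comp (C q * X) * (1 + X ^ 4)) := by
  have h1 : (C q * X : ℝ[X]).comp (-X) = (-X).comp (C q * X) := by simp
  rw [mul_comp, comp_assoc, h1, ← comp_assoc, S.P_comp_neg, mul_comp]
  simp only [pow_comp, neg_comp, one_comp, add_comp, X_comp]
  ring

/-- The middle coefficient in the expansion of `(1 + x⁴) P_n(qx)`. -/
noncomputable def r (n : ℕ) : ℝ :=
  S.L ((S.P n).comp (C q * X) * (1 + X ^ 4) * S.P (n + 2)) / S.γ (n + 2)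

lemma dilate_expansion (hq : q ≠ 0) (n : ℕ) :
    (S.P n).comp (C q * X) * (1 + X ^ 4) =
      C (q ^ n) * S.P (n + 4) + C (S.r n) * S.P (n + 2) + C (q⁻¹ ^ (n + 1)) * S.P n := by
  rw [← sub_eq_zero]
  refine S.eq_zero_of_map_mul (N := n + 5) ?_ fun k hk => ?_
  · refine Nat.lt_succ_of_le ((natDegree_sub_le _ _).trans (max_le (S.natDegree_dilate_le n) ?_))
    refine natDegree_add_le_of_degree_le (natDegree_add_le_of_degree_le ?_ ?_) ?_ <;>
    exact (natDegree_C_mul_le _ _).trans ((S.deg _).le.trans (by omega))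
  · rw [sub_mul, add_mul, add_mul, map_sub, map_add, map_add]
    simp only [S.map_C_mul_mul]
    have hγ := (S.γ_pos (n + 2)).ne'
    by_cases hodd : Odd (n + k)
    · have : ¬ Even (n + k) := by simpa using hodd
      rw [if_neg, if_neg, if_neg,
        S.map_mul_eq_zero_of_odd (S.dilate_comp_neg n) hodd]
      · simp
      all_goals (rintro rfl; apply this; rw [Nat.even_iff]; omega)
    rw [Nat.not_odd_iff_even] at hodd
    obtain ⟨j, hj⟩ := hodd
    have hlow : k ≤ n → S.L ((S.P n).comp (C q * X) * (1 + X ^ 4) * S.P k) =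
        q⁻¹ * ((S.P k).coeff n * q⁻¹ ^ n * S.γ n) := by
      intro hk
      rw [S.map_scale_mul hq, mul_comm (S.P n), S.map_mul_of_natDegree_le, comp_C_mul_X_coeff]
      exact (natDegree_comp_C_mul_X_le _ _).trans (by rw [S.deg]; exact hk)
    obtain h | rfl | rfl | rfl : k < n ∨ k = n ∨ k = n + 2 ∨ k = n + 4 := by omega
    · rw [if_neg (by omega), if_neg (by omega), if_neg (by omega), hlow h.le,
        coeff_eq_zero_of_natDegree_lt (by rw [S.deg]; exact h)]
      simp
    · rw [if_neg (by omega), if_neg (by omega), if_pos rfl, hlow le_rfl, S.coeff_self]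
      ring
    · rw [if_neg (by omega), if_pos rfl, if_neg (by omega), r]
      field_simp
      ring
    · rw [if_pos rfl, if_neg (by omega), if_neg (by omega),
        S.map_mul_of_natDegree_le (S.natDegree_dilate_le n), S.coeff_dilate, S.coeff_self,
        coeff_eq_zero_of_natDegree_lt (by rw [S.deg]; omega)]
      ring

lemma contract_comp_neg (n : ℕ) : ((S.P n).comp (C q⁻¹ * X)).comp (-X) =
    (-1) ^ n * ((S.P n).comp (C q⁻¹ * X)) := by
  have h1 : (C q⁻¹ * X : ℝ[X]).comp (-X) = (-X).comp (C q⁻¹ * X) := by simp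
  rw [comp_assoc, h1, ← comp_assoc, S.P_comp_neg, mul_comp]
  simp only [pow_comp, neg_comp, one_comp]

lemma contract_expansion (hq : q ≠ 0) (n : ℕ) :
    (S.P (n + 4)).comp (C q⁻¹ * X) =
      C (q⁻¹ ^ (n + 4)) * S.P (n + 4) +
      C (q * S.r (n + 2) * S.α (n + 4) * S.α (n + 3)) * S.P (n + 2) +
      C (q ^ (n + 1) * S.α (n + 4) * S.α (n + 3) * S.α (n + 2) * S.α (n + 1)) * S.P n := by
  rw [← sub_eq_zero]
  refine S.eq_zero_of_map_mul (N := n + 5) ?_ fun k hk => ?_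
  · refine Nat.lt_succ_of_le ((natDegree_sub_le _ _).trans (max_le ?_ ?_))
    · exact (natDegree_comp_C_mul_X_le _ _).trans (S.deg _).le
    refine natDegree_add_le_of_degree_le (natDegree_add_le_of_degree_le ?_ ?_) ?_ <;>
    exact (natDegree_C_mul_le _ _).trans ((S.deg _).le.trans (by omega))
  · rw [sub_mul, add_mul, add_mul, map_sub, map_add, map_add]
    simp only [S.map_C_mul_mul]
    by_cases hodd : Odd (n + k)
    · have : ¬ Even (n + k) := by simpa using hodd
      rw [if_neg, if_neg, if_neg,
        S.map_mul_eq_zero_of_odd (S.contract_comp_neg (n + 4)) (by rw [Nat.odd_iff] at *; omega)]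
      · simp
      all_goals (rintro rfl; apply this; rw [Nat.even_iff]; omega)
    rw [Nat.not_odd_iff_even] at hodd
    obtain ⟨j, hj⟩ := hodd
    have hadj : S.L ((S.P (n + 4)).comp (C q⁻¹ * X) * S.P k) =
        q * S.L ((S.P k).comp (C q * X) * (1 + X ^ 4) * S.P (n + 4)) := by
      rw [S.map_scale_mul hq, ← mul_assoc, mul_inv_cancel₀ hq, one_mul, mul_comm]
    have hγ := (S.γ_pos (n + 4)).ne'
    have h1 := S.γ_succ n
    have h2 := S.γ_succ (n + 1)
    have h3 := S.γ_succ (n + 2)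
    have h4 := S.γ_succ (n + 3)
    obtain h | rfl | rfl | rfl : k < n ∨ k = n ∨ k = n + 2 ∨ k = n + 4 := by omega
    · rw [if_neg (by omega), if_neg (by omega), if_neg (by omega), hadj,
        S.map_mul_of_natDegree_lt ((S.natDegree_dilate_le k).trans_lt (by omega))]
      simp
    · rw [if_neg (by omega), if_neg (by omega), if_pos rfl, hadj,
        S.map_mul_of_natDegree_le (S.natDegree_dilate_le k), S.coeff_dilate, S.coeff_self,
        coeff_eq_zero_of_natDegree_lt (by rw [S.deg]; omega), h4, h3, h2, h1]
      ring
    · have hr : S.L ((S.P (n + 2)).comp (C q * X) * (1 + X ^ 4) * S.P (n + 4)) =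
          S.r (n + 2) * S.γ (n + 4) := by
        rw [r, div_mul_cancel₀ _ hγ]
      rw [if_neg (by omega), if_pos rfl, if_neg (by omega), hadj, hr, h4, h3]
      ring
    · rw [if_pos rfl, if_neg (by omega), if_neg (by omega),
        S.map_mul_of_natDegree_le
          ((natDegree_comp_C_mul_X_le _ _).trans (S.deg _).le), comp_C_mul_X_coeff, S.coeff_self]
      ring

/-- The subleading coefficient `[x^n] P_{n+2}`. -/
noncomputable def subCoeff (n : ℕ) : ℝ := (S.P (n + 2)).coeff n

lemma subCoeff_succ (n : ℕ) : S.subCoeff (n + 1) = S.subCoeff n - S.α (n + 2) := by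
  rw [subCoeff, S.P_add_two, coeff_sub, coeff_X_mul, coeff_C_mul, S.coeff_self, mul_one, subCoeff]

lemma r_add_two (hq : q ≠ 0) (n : ℕ) :
    S.r (n + 2) = q ^ n * S.subCoeff n - q ^ (n + 2) * S.subCoeff (n + 4) := by
  have h := congrArg (fun p => p.coeff (n + 4)) (S.dilate_expansion hq (n + 2))
  simp only [coeff_dilate, coeff_add, coeff_C_mul, coeff_self] at h
  rw [coeff_eq_zero_of_natDegree_lt (by rw [S.deg]; omega)] at h
  simp only [subCoeff]
  linear_combination -h

lemma coeff_zero_add_two (n : ℕ) :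
    (S.P (n + 2)).coeff 0 = - S.α (n + 1) * (S.P n).coeff 0 := by
  rw [S.P_add_two, coeff_sub, coeff_X_mul_zero, coeff_C_mul]
  ring

lemma coeff_zero_ne_zero (m : ℕ) : (S.P (2 * m)).coeff 0 ≠ 0 := by
  induction m with
  | zero => simp [S.P_zero]
  | succ m ih =>
    rw [show 2 * (m + 1) = 2 * m + 2 by ring, S.coeff_zero_add_two]
    exact mul_ne_zero (neg_ne_zero.mpr (S.α_pos _).ne') ih

/-- The lower-order part of the off-diagonal entry of the dilation matrix of `(P_n, P_{n+1})`,
at index `n + 4`. -/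
noncomputable def offDiag (n : ℕ) : ℝ :=
  q ^ (n + 2) * S.subCoeff (n + 2) - q ^ (n + 4) * S.subCoeff (n + 4)

lemma r_eq_offDiag (hq : q ≠ 0) (n : ℕ) :
    S.r (n + 4) = S.offDiag n + q ^ (n + 4) * (S.α (n + 6) + S.α (n + 7)) := by
  rw [S.r_add_two hq (n + 2), offDiag, S.subCoeff_succ (n + 5), S.subCoeff_succ (n + 4)]
  ring

lemma r_offDiag_constraint (hq : q ≠ 0) (n : ℕ) (hn : Even n) :
    q ^ (n + 4) * S.α (n + 7) * S.α (n + 5) - S.r (n + 4) * S.α (n + 5) + q⁻¹ ^ (n + 5) = 1 := by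
  obtain ⟨m, rfl⟩ := hn
  have h := congrArg (fun p => p.coeff 0) (S.dilate_expansion hq (m + m + 4))
  simp only [coeff_dilate_of_lt _ _ _ (show 0 < 4 by norm_num), coeff_add, coeff_C_mul,
    coeff_zero_add_two] at h
  have h0 := S.coeff_zero_ne_zero m
  rw [two_mul] at h0
  have h5 := (S.α_pos (m + m + 2 + 1)).ne'
  have h6 := (S.α_pos (m + m + 1)).ne'
  refine mul_right_cancel₀ (mul_ne_zero (mul_ne_zero h5 h6) h0) ?_
  linear_combination -h

lemma offDiag_eq (hq : q ≠ 0) (n : ℕ) (hn : Even n) :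
    S.offDiag n * S.α (n + 5) =
      q⁻¹ ^ (n + 5) - 1 - q ^ (n + 4) * S.α (n + 6) * S.α (n + 5) := by
  linear_combination -S.r_offDiag_constraint hq n hn - S.α (n + 5) * S.r_eq_offDiag hq n

/-- First row of the dilation matrix. -/
lemma dilate_eq (hq : q ≠ 0) (n : ℕ) (hn : Even n) :
    (S.P (n + 4)).comp (C q * X) * (1 + X ^ 4) =
      (1 - C (q ^ (n + 4) * S.α (n + 5)) * X ^ 2) * S.P (n + 4) +
      X * (C (S.offDiag n) + C (q ^ (n + 4)) * X ^ 2) * S.P (n + 5) := by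
  have h1 := S.P_add_two (n + 4)
  have h2 := S.P_add_two (n + 5)
  have h3 := S.P_add_two (n + 6)
  have h4 := congrArg C (S.r_offDiag_constraint hq n hn)
  have h5 := congrArg C (S.r_eq_offDiag hq n)
  rw [S.dilate_expansion hq (n + 4)]
  simp only [add_assoc, Nat.reduceAdd] at *
  simp only [C_mul, C_add, C_sub, C_1] at *
  linear_combination C (q ^ (n + 4)) * h3 + C (q ^ (n + 4)) * X * h2 +
    (C (q ^ (n + 4)) * (X ^ 2 - C (S.α (n + 7))) + C (S.r (n + 4))) * h1 +
    S.P (n + 4) * h4 + X * S.P (n + 5) * h5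

/-- First row of the inverse dilation matrix. -/
lemma contract_eq (hq : q ≠ 0) (n : ℕ) (hn : Even n) :
    (S.P (n + 4)).comp (C q⁻¹ * X) =
      (1 + C (q ^ (n + 1)) * X ^ 4 +
        C (S.offDiag n * q⁻¹ - q ^ (n + 1) * S.α (n + 4)) * X ^ 2) * S.P (n + 4) -
      X * (C (S.offDiag n * q⁻¹) + C (q ^ (n + 1)) * X ^ 2) * S.P (n + 5) := by
  have h1 := S.P_add_two n
  have h2 := S.P_add_two (n + 1)
  have h3 := S.P_add_two (n + 2)
  have h4 := S.P_add_two (n + 3)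
  have hσ : q * S.r (n + 2) = q ^ (n + 1) * (S.α (n + 3) + S.α (n + 2)) + S.offDiag n * q⁻¹ := by
    rw [S.r_add_two hq n, offDiag, S.subCoeff_succ (n + 1), S.subCoeff_succ n]
    field_simp
    ring
  have hraw : (S.P (n + 4)).comp (C q⁻¹ * X) =
      (C (q⁻¹ ^ (n + 4) - S.α (n + 4) * S.offDiag n * q⁻¹
          - q ^ (n + 1) * S.α (n + 4) * S.α (n + 3)) + C (q ^ (n + 1)) * X ^ 4 +
        C (S.offDiag n * q⁻¹ - q ^ (n + 1) * S.α (n + 4)) * X ^ 2) * S.P (n + 4) -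
      X * (C (S.offDiag n * q⁻¹) + C (q ^ (n + 1)) * X ^ 2) * S.P (n + 5) := by
    have h5 := congrArg C hσ
    rw [S.contract_expansion hq n]
    simp only [add_assoc, Nat.reduceAdd] at *
    simp only [C_mul, C_add, C_sub] at *
    linear_combination (C (q ^ (n + 1)) * C (S.α (n + 4)) * C (S.α (n + 3)) * C (S.α (n + 2))) * h1
      + C (q ^ (n + 1)) * C (S.α (n + 4)) * C (S.α (n + 3)) * X * h2
      + (C (q ^ (n + 1)) * C (S.α (n + 4)) * (X ^ 2 - C (S.α (n + 2)))
          + C q * C (S.r (n + 2)) * C (S.α (n + 4))) * h3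
      + (C (q ^ (n + 1)) * ((X ^ 2 - C (S.α (n + 2))) * X - C (S.α (n + 3)) * X)
          + C q * C (S.r (n + 2)) * X) * h4
      + ((X ^ 2 - C (S.α (n + 4))) * S.P (n + 4) - X * S.P (n + 5)) * h5
  have h0 : q⁻¹ ^ (n + 4) - S.α (n + 4) * S.offDiag n * q⁻¹
      - q ^ (n + 1) * S.α (n + 4) * S.α (n + 3) = 1 := by
    have h := congrArg (eval 0) hraw
    have hne : (S.P (n + 4)).coeff 0 ≠ 0 := by
      obtain ⟨m, rfl⟩ := hn
      have := S.coeff_zero_ne_zero (m + 2)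
      rwa [show 2 * (m + 2) = m + m + 4 by ring] at this
    rw [coeff_zero_eq_eval_zero] at hne
    simp only [eval_comp, eval_mul, eval_add, eval_sub, eval_C, eval_X, eval_pow] at h
    refine mul_right_cancel₀ hne ?_
    simp only [mul_zero] at h
    linear_combination -h
  rw [hraw, h0, C_1]

/-- The identity that determines `offDiag`, read off from the `x²` coefficients. -/
lemma offDiag_mul (hq : q ≠ 0) (n : ℕ) (hn : Even n) :
    S.offDiag n * (q + (1 - q) * ((S.P (n + 5)).coeff 1 / (S.P (n + 4)).coeff 0)) =
      q ^ (n + 3) * S.α (n + 4) + q ^ (n + 4) * S.α (n + 5) := by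
  have hne : (S.P (n + 4)).coeff 0 ≠ 0 := by
    obtain ⟨m, rfl⟩ := hn
    have := S.coeff_zero_ne_zero (m + 2)
    rwa [show 2 * (m + 2) = m + m + 4 by ring] at this
  have h1 := congrArg (fun p => p.coeff 2) (S.dilate_eq hq n hn)
  have h2 := congrArg (fun p => p.coeff 2) (S.contract_eq hq n hn)
  have hd : ∀ (p r : ℝ[X]) (a b c : ℝ), ((1 - C a * X ^ 2) * p + X * (C b + C c * X ^ 2) * r).coeff 2
      = p.coeff 2 - a * p.coeff 0 + b * r.coeff 1 := by
    intro p r a b c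
    rw [show (1 - C a * X ^ 2) * p + X * (C b + C c * X ^ 2) * r =
      p - C a * (X ^ 2 * p) + C b * (X ^ 1 * r) + C c * (X ^ 3 * r) by ring]
    simp [coeff_X_pow_mul']
  have hc : ∀ (p r : ℝ[X]) (a b c d : ℝ), ((1 + C a * X ^ 4 + C b * X ^ 2) * p -
      X * (C c + C d * X ^ 2) * r).coeff 2 = p.coeff 2 + b * p.coeff 0 - c * r.coeff 1 := by
    intro p r a b c d
    rw [show (1 + C a * X ^ 4 + C b * X ^ 2) * p - X * (C c + C d * X ^ 2) * r =
      p + C a * (X ^ 4 * p) + C b * (X ^ 2 * p) - C c * (X ^ 1 * r) - C d * (X ^ 3 * r) by ring]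
    simp [coeff_X_pow_mul']
  simp only [hd, S.coeff_dilate_of_lt _ _ (show 2 < 4 by norm_num)] at h1
  simp only [hc, comp_C_mul_X_coeff] at h2
  field_simp at h2 ⊢
  linear_combination -h2 - h1

end QFreudSystem

/-- The reciprocal of the weight as a function of `x⁴`. -/
noncomputable def qprod (q x : ℝ) : ℝ := ∏' j : ℕ, (1 + x * q ^ (4 * j))

section Weight

variable {q : ℝ}

lemma summable_qprod (hq0 : 0 < q) (hq1 : q < 1) (x : ℝ) :
    Summable fun j : ℕ => x * q ^ (4 * j) := by
  simp only [pow_mul]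
  exact (summable_geometric_of_lt_one (by positivity) (pow_lt_one₀ hq0.le hq1 (by norm_num))).mul_left x

lemma multipliable_qprod (hq0 : 0 < q) (hq1 : q < 1) (x : ℝ) :
    Multipliable fun j : ℕ => 1 + x * q ^ (4 * j) :=
  Real.multipliable_one_add_of_summable (summable_qprod hq0 hq1 x)

lemma qprod_eq (hq0 : 0 < q) (hq1 : q < 1) (x : ℝ) :
    qprod q x = (1 + x) * qprod q (q ^ 4 * x) := by
  unfold qprod
  have h : ∀ j : ℕ, 1 + x * q ^ (4 * (j + 1)) = 1 + q ^ 4 * x * q ^ (4 * j) := fun j => by ring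
  rw [tprod_eq_zero_mul']
  · simp only [h, mul_zero, pow_zero, mul_one]
  · simp only [h]
    exact multipliable_qprod hq0 hq1 _

lemma one_le_qprod (hq0 : 0 < q) (hq1 : q < 1) {x : ℝ} (hx : 0 ≤ x) : 1 ≤ qprod q x :=
  ge_of_tendsto' (multipliable_qprod hq0 hq1 x).hasProd.tendsto_prod_nat fun n =>
    Finset.prod_induction _ (fun y => 1 ≤ y) (fun _ _ => one_le_mul_of_one_le_of_one_le) le_rfl
      fun i _ => le_add_of_nonneg_right (by positivity)

lemma qprod_le_exp (hq0 : 0 < q) (hq1 : q < 1) {x : ℝ} (hx : 0 ≤ x) :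
    qprod q x ≤ Real.exp (x * ∑' j : ℕ, q ^ (4 * j)) := by
  refine le_of_tendsto' (multipliable_qprod hq0 hq1 x).hasProd.tendsto_prod_nat fun n => ?_
  rw [← tsum_mul_left]
  calc ∏ i ∈ Finset.range n, (1 + x * q ^ (4 * i))
      ≤ ∏ i ∈ Finset.range n, Real.exp (x * q ^ (4 * i)) :=
        Finset.prod_le_prod (fun i _ => by positivity)
          fun i _ => by linarith [Real.add_one_le_exp (x * q ^ (4 * i))]
    _ = Real.exp (∑ i ∈ Finset.range n, x * q ^ (4 * i)) := (Real.exp_sum _ _).symm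
    _ ≤ _ := Real.exp_le_exp.mpr
        ((summable_qprod hq0 hq1 x).sum_le_tsum _ fun i _ => by positivity)

lemma exists_qprod_sub_one_le (hq0 : 0 < q) (hq1 : q < 1) :
    ∃ K : ℝ, 0 ≤ K ∧ ∀ x, 0 ≤ x → x ≤ 1 → qprod q x - 1 ≤ K * x := by
  set A : ℝ := ∑' j : ℕ, q ^ (4 * j)
  have hA : 0 ≤ A := tsum_nonneg fun j => by positivity
  refine ⟨A * Real.exp A, by positivity, fun x h0 h1 => ?_⟩
  have hx : x * A ≤ A := mul_le_of_le_one_left hA h1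
  have h2 : Real.exp (x * A) - 1 ≤ x * A * Real.exp (x * A) := by
    have := Real.add_one_le_exp (-(x * A))
    rw [Real.exp_neg] at this
    have hp := Real.exp_pos (x * A)
    have := mul_le_mul_of_nonneg_right this hp.le
    rw [inv_mul_cancel₀ hp.ne'] at this
    linarith
  calc qprod q x - 1 ≤ Real.exp (x * A) - 1 := by linarith [qprod_le_exp hq0 hq1 h0]
    _ ≤ x * A * Real.exp (x * A) := h2
    _ ≤ x * A * Real.exp A := by gcongr
    _ = A * Real.exp A * x := by ring

lemma qweight_eq (hq0 : 0 < q) (hq1 : q < 1) (x : ℝ) : qweight q x = (qprod q (x ^ 4))⁻¹ := by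
  have h := one_le_qprod hq0 hq1 (x := x ^ 4) (by positivity)
  exact (multipliable_qprod hq0 hq1 (x ^ 4)).tprod_inv₀ (by unfold qprod at h; linarith)

lemma qweight_neg (q x : ℝ) : qweight q (-x) = qweight q x := by
  simp only [qweight, Even.neg_pow (show Even 4 by decide)]

/-- The lattice masses of the weight on the positive half of `±qᶻ`. -/
noncomputable def latticeWeight (q : ℝ) (k : ℤ) : ℝ := qweight q (q ^ k) * q ^ k

/-- The Gaussian lattice masses that approximate `latticeWeight` as `k → -∞`. -/
noncomputable def gaussWeight (q : ℝ) (k : ℤ) : ℝ :=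
  qweight q 1 * (qprod q (q ^ 4))⁻¹ * q ^ (2 * k ^ 2 - k)

lemma qweight_pos (hq0 : 0 < q) (hq1 : q < 1) (x : ℝ) : 0 < qweight q x := by
  rw [qweight_eq hq0 hq1]
  have := one_le_qprod hq0 hq1 (x := x ^ 4) (by positivity)
  positivity

lemma qweight_le_one (hq0 : 0 < q) (hq1 : q < 1) (x : ℝ) : qweight q x ≤ 1 := by
  rw [qweight_eq hq0 hq1]
  exact inv_le_one_of_one_le₀ (one_le_qprod hq0 hq1 (by positivity))

lemma qweight_mul (hq0 : 0 < q) (hq1 : q < 1) (x : ℝ) :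
    qweight q (q * x) = (1 + x ^ 4) * qweight q x := by
  rw [qweight_eq hq0 hq1, qweight_eq hq0 hq1, qprod_eq hq0 hq1 (x ^ 4), mul_pow]
  have : (0 : ℝ) < 1 + x ^ 4 := by positivity
  field_simp

lemma latticeWeight_pos (hq0 : 0 < q) (hq1 : q < 1) (k : ℤ) : 0 < latticeWeight q k :=
  mul_pos (qweight_pos hq0 hq1 _) (zpow_pos hq0 _)

lemma gaussConst_pos (hq0 : 0 < q) (hq1 : q < 1) : 0 < qweight q 1 * (qprod q (q ^ 4))⁻¹ := by
  have := one_le_qprod hq0 hq1 (x := q ^ 4) (by positivity)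
  have := qweight_pos hq0 hq1 1
  positivity

lemma gaussWeight_pos (hq0 : 0 < q) (hq1 : q < 1) (k : ℤ) : 0 < gaussWeight q k :=
  mul_pos (gaussConst_pos hq0 hq1) (zpow_pos hq0 _)

lemma latticeWeight_le (hq0 : 0 < q) (hq1 : q < 1) (k : ℤ) : latticeWeight q k ≤ q ^ k :=
  mul_le_of_le_one_left (zpow_pos hq0 _).le (qweight_le_one hq0 hq1 _)

lemma latticeWeight_add_one (hq0 : 0 < q) (hq1 : q < 1) (k : ℤ) :
    latticeWeight q (k + 1) = q * ((1 + (q ^ k) ^ 4) * latticeWeight q k) := by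
  rw [latticeWeight, zpow_add_one₀ hq0.ne', mul_comm _ q, qweight_mul hq0 hq1, latticeWeight]
  ring

lemma latticeWeight_eq (hq0 : 0 < q) (hq1 : q < 1) (k : ℤ) :
    latticeWeight q k = gaussWeight q k * qprod q (q ^ (4 - 4 * k)) := by
  have hstep : ∀ k : ℤ, latticeWeight q k = gaussWeight q k * qprod q (q ^ (4 - 4 * k)) ↔
      latticeWeight q (k + 1) = gaussWeight q (k + 1) * qprod q (q ^ (4 - 4 * (k + 1))) := by
    intro k
    have h1 : gaussWeight q (k + 1) = gaussWeight q k * q * (q ^ k) ^ 4 := by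
      have : q ^ (2 * (k + 1) ^ 2 - (k + 1)) = q ^ (2 * k ^ 2 - k) * q * (q ^ k) ^ 4 := by
        rw [← zpow_natCast (q ^ k) 4, ← zpow_mul, ← zpow_add_one₀ hq0.ne', ← zpow_add₀ hq0.ne']
        congr 1
        push_cast
        ring
      rw [gaussWeight, this, gaussWeight]
      ring
    have h2 : qprod q (q ^ (4 - 4 * (k + 1))) = (1 + ((q ^ k) ^ 4)⁻¹) * qprod q (q ^ (4 - 4 * k)) := by
      have e1 : q ^ (4 - 4 * (k + 1)) = ((q ^ k) ^ 4)⁻¹ := by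
        rw [← zpow_natCast (q ^ k) 4, ← zpow_mul, ← zpow_neg]
        congr 1
        push_cast
        ring
      rw [qprod_eq hq0 hq1, e1]
      congr 2
      rw [← e1, ← zpow_natCast q 4, ← zpow_add₀ hq0.ne']
      congr 1
      push_cast
      ring
    rw [latticeWeight_add_one hq0 hq1, h1, h2]
    have hk := zpow_pos hq0 k
    have e : gaussWeight q k * q * (q ^ k) ^ 4 *
        ((1 + ((q ^ k) ^ 4)⁻¹) * qprod q (q ^ (4 - 4 * k))) =
        q * ((1 + (q ^ k) ^ 4) * (gaussWeight q k * qprod q (q ^ (4 - 4 * k)))) := by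
      field_simp
      ring
    rw [e]
    constructor
    · intro h; rw [h]
    · intro h
      exact mul_left_cancel₀ (by positivity) (mul_left_cancel₀ hq0.ne' h)
  induction k using Int.induction_on with
  | zero =>
    have := one_le_qprod hq0 hq1 (x := q ^ 4) (by positivity)
    have h4 : q ^ (4 : ℤ) = q ^ 4 := by norm_cast
    simp only [latticeWeight, gaussWeight, zpow_zero, mul_zero, sub_zero, mul_one, h4]
    norm_num
    field_simp
  | succ i h => exact (hstep _).mp h
  | pred i h => exact (hstep _).mpr (by rwa [sub_add_cancel])

lemma gaussWeight_le (hq0 : 0 < q) (hq1 : q < 1) (k : ℤ) : gaussWeight q k ≤ latticeWeight q k := by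
  rw [latticeWeight_eq hq0 hq1]
  exact le_mul_of_one_le_right (gaussWeight_pos hq0 hq1 k).le
    (one_le_qprod hq0 hq1 (zpow_pos hq0 _).le)

lemma exists_latticeWeight_sub_le (hq0 : 0 < q) (hq1 : q < 1) :
    ∃ K : ℝ, 0 ≤ K ∧ ∀ k : ℤ, k ≤ 0 →
      latticeWeight q k - gaussWeight q k ≤ K * q ^ (-(4 * k)) * gaussWeight q k := by
  obtain ⟨K, hK0, hK⟩ := exists_qprod_sub_one_le hq0 hq1
  refine ⟨K, hK0, fun k hk => ?_⟩
  have hmono : ∀ a b : ℤ, a ≤ b → q ^ b ≤ q ^ a := fun a b h =>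
    zpow_le_zpow_right_of_le_one₀ hq0 hq1.le h
  have h1 := hK (q ^ (4 - 4 * k)) (zpow_pos hq0 _).le
    (by rw [← zpow_zero q]; exact hmono _ _ (by omega))
  have h2 := hmono (-(4 * k)) (4 - 4 * k) (by omega)
  rw [latticeWeight_eq hq0 hq1]
  have h3 := gaussWeight_pos hq0 hq1 k
  have h4 : K * q ^ (4 - 4 * k) ≤ K * q ^ (-(4 * k)) := mul_le_mul_of_nonneg_left h2 hK0
  nlinarith

end Weight

section Functional

variable {q : ℝ} {v : ℤ → ℝ}

lemma summable_eval_mul (hv : ∀ j : ℕ, Summable fun k : ℤ => (q ^ k) ^ j * v k) (p : ℝ[X]) :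
    Summable fun k : ℤ => p.eval (q ^ k) * v k := by
  simp only [eval_eq_sum_range, Finset.sum_mul, mul_assoc]
  exact summable_sum fun i _ => (hv i).mul_left _

lemma summable_eval_add_mul (hv : ∀ j : ℕ, Summable fun k : ℤ => (q ^ k) ^ j * v k) (p : ℝ[X]) :
    Summable fun k : ℤ => (p.eval (q ^ k) + p.eval (-q ^ k)) * v k := by
  have h := summable_eval_mul hv (p.comp (-X))
  simp only [eval_comp, eval_neg, eval_X] at h
  simpa only [add_mul] using (summable_eval_mul hv p).add h

/-- The functional `p ↦ ∑ₖ (p(qᵏ) + p(-qᵏ)) v(k)` on polynomials. -/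
noncomputable def latticeFunctional (q : ℝ) (v : ℤ → ℝ)
    (hv : ∀ j : ℕ, Summable fun k : ℤ => (q ^ k) ^ j * v k) : ℝ[X] →ₗ[ℝ] ℝ where
  toFun p := ∑' k : ℤ, (p.eval (q ^ k) + p.eval (-q ^ k)) * v k
  map_add' p r := by
    rw [← (summable_eval_add_mul hv p).tsum_add (summable_eval_add_mul hv r)]
    congr 1
    ext k
    simp only [eval_add]
    ring
  map_smul' c p := by
    rw [RingHom.id_apply, smul_eq_mul, ← tsum_mul_left]
    congr 1
    ext k
    simp only [eval_smul, smul_eq_mul]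
    ring

variable (hv : ∀ j : ℕ, Summable fun k : ℤ => (q ^ k) ^ j * v k)

lemma latticeFunctional_apply (p : ℝ[X]) : latticeFunctional q v hv p =
    ∑' k : ℤ, (p.eval (q ^ k) + p.eval (-q ^ k)) * v k := rfl

lemma latticeFunctional_comp_neg (p : ℝ[X]) :
    latticeFunctional q v hv (p.comp (-X)) = latticeFunctional q v hv p := by
  simp only [latticeFunctional_apply, eval_comp, eval_neg, eval_X, neg_neg]
  congr 1
  ext k
  ring

lemma summable_pow_natAbs (hq0 : 0 < q) (hq1 : q < 1) : Summable fun k : ℤ => q ^ k.natAbs := by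
  refine Summable.of_nat_of_neg ?_ ?_ <;>
  simpa using summable_geometric_of_lt_one hq0.le hq1

lemma zpow_le_of_le (hq0 : 0 < q) (hq1 : q < 1) {a b : ℤ} (h : a ≤ b) : q ^ b ≤ q ^ a :=
  zpow_le_zpow_right_of_le_one₀ hq0 hq1.le h

lemma exists_latticeWeight_le_gauss (hq0 : 0 < q) (hq1 : q < 1) :
    ∃ K : ℝ, 0 < K ∧ ∀ k : ℤ, k ≤ 0 → latticeWeight q k ≤ K * q ^ (2 * k ^ 2 - k) := by
  obtain ⟨K, hK0, hK⟩ := exists_latticeWeight_sub_le hq0 hq1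
  have hc := gaussConst_pos hq0 hq1
  refine ⟨(1 + K) * (qweight q 1 * (qprod q (q ^ 4))⁻¹), by positivity, fun k hk => ?_⟩
  have h1 := hK k hk
  have h2 := gaussWeight_pos hq0 hq1 k
  have h3 : q ^ (-(4 * k)) ≤ 1 := by
    rw [← zpow_zero q]
    exact zpow_le_of_le hq0 hq1 (by omega)
  have h4 : K * q ^ (-(4 * k)) * gaussWeight q k ≤ K * 1 * gaussWeight q k := by gcongr
  calc latticeWeight q k ≤ (1 + K) * gaussWeight q k := by linarith
    _ = _ := by rw [gaussWeight]; ring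

lemma exists_moment_le (hq0 : 0 < q) (hq1 : q < 1) (j : ℕ) :
    ∃ K : ℝ, ∀ k : ℤ, (q ^ k) ^ j * latticeWeight q k ≤ K * q ^ k.natAbs := by
  obtain ⟨K, hK0, hK⟩ := exists_latticeWeight_le_gauss hq0 hq1
  refine ⟨1 + K * q ^ (-(j : ℤ) ^ 2), fun k => ?_⟩
  have hpos := zpow_pos hq0 (-(j : ℤ) ^ 2)
  rw [← zpow_natCast q k.natAbs, ← zpow_natCast (q ^ k) j, ← zpow_mul]
  have hk := zpow_pos hq0 (k * j)
  have habs := zpow_pos hq0 (k.natAbs : ℤ)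
  rcases le_total 0 k with h | h
  · have e : (k.natAbs : ℤ) = k := Int.natAbs_of_nonneg h
    rw [e] at *
    calc q ^ (k * j) * latticeWeight q k ≤ 1 * q ^ k := by
          refine mul_le_mul ?_ (latticeWeight_le hq0 hq1 k) (latticeWeight_pos hq0 hq1 k).le zero_le_one
          rw [← zpow_zero q]
          exact zpow_le_of_le hq0 hq1 (by positivity)
      _ ≤ _ := by gcongr; nlinarith
  · have e : (k.natAbs : ℤ) = -k := Int.ofNat_natAbs_of_nonpos h
    rw [e] at *
    calc q ^ (k * j) * latticeWeight q k ≤ q ^ (k * j) * (K * q ^ (2 * k ^ 2 - k)) := by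
          gcongr
          exact hK k h
      _ = K * q ^ (k * j + (2 * k ^ 2 - k)) := by rw [zpow_add₀ hq0.ne']; ring
      _ ≤ K * q ^ (-(j : ℤ) ^ 2 + -k) := by
          gcongr ?_ * ?_
          exact zpow_le_of_le hq0 hq1 (by nlinarith [sq_nonneg (2 * k + j : ℤ), sq_nonneg (j : ℤ), sq_nonneg k])
      _ = K * q ^ (-(j : ℤ) ^ 2) * q ^ (-k) := by rw [zpow_add₀ hq0.ne']; ring
      _ ≤ _ := by gcongr; linarith

lemma summable_latticeWeight (hq0 : 0 < q) (hq1 : q < 1) (j : ℕ) :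
    Summable fun k : ℤ => (q ^ k) ^ j * latticeWeight q k := by
  obtain ⟨K, hK⟩ := exists_moment_le hq0 hq1 j
  refine Summable.of_nonneg_of_le (fun k => ?_) hK ((summable_pow_natAbs hq0 hq1).mul_left K)
  have := latticeWeight_pos hq0 hq1 k
  have := zpow_pos hq0 k
  positivity

lemma summable_gaussWeight (hq0 : 0 < q) (hq1 : q < 1) (j : ℕ) :
    Summable fun k : ℤ => (q ^ k) ^ j * gaussWeight q k := by
  refine Summable.of_nonneg_of_le (fun k => ?_) (fun k => ?_) (summable_latticeWeight hq0 hq1 j)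
  · have := gaussWeight_pos hq0 hq1 k
    have := zpow_pos hq0 k
    positivity
  · have := zpow_pos hq0 k
    exact mul_le_mul_of_nonneg_left (gaussWeight_le hq0 hq1 k) (by positivity)

/-- The orthogonality functional of the weight. -/
noncomputable def weightFunctional (hq0 : 0 < q) (hq1 : q < 1) : ℝ[X] →ₗ[ℝ] ℝ :=
  latticeFunctional q (latticeWeight q) (summable_latticeWeight hq0 hq1)

lemma weightFunctional_scale (hq0 : 0 < q) (hq1 : q < 1) (p : ℝ[X]) :
    weightFunctional hq0 hq1 (p.comp (C q * X) * (1 + X ^ 4)) = q⁻¹ * weightFunctional hq0 hq1 p := by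
  simp only [weightFunctional, latticeFunctional_apply]
  rw [← (Equiv.addRight (1 : ℤ)).tsum_eq
    (fun k => (p.eval (q ^ k) + p.eval (-q ^ k)) * latticeWeight q k), ← tsum_mul_left]
  congr 1
  ext k
  simp only [Equiv.coe_addRight, eval_mul, eval_comp, eval_add, eval_one, eval_pow, eval_X, eval_C,
    latticeWeight_add_one hq0 hq1, zpow_add_one₀ hq0.ne']
  rw [Even.neg_pow (show Even 4 by decide), mul_neg, mul_comm (q ^ k) q]
  field_simp

/-- The system attached to an orthogonal family for `qweight`. -/
noncomputable def MonicOrthFamily.toQFreudSystem (hq0 : 0 < q) (hq1 : q < 1)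
    (F : MonicOrthFamily q 1) : QFreudSystem q where
  L := weightFunctional hq0 hq1
  P := F.P
  γ := F.γ
  monic := F.monic
  deg := F.deg
  γ_pos := F.γ_pos
  orth n m := by
    rw [← F.orth n m, weightFunctional, latticeFunctional_apply]
    congr 1
    ext k
    simp only [one_mul, qweight_neg, eval_mul, latticeWeight]
    ring
  map_reflect := latticeFunctional_comp_neg _
  map_scale := weightFunctional_scale hq0 hq1

end Functional

section Ucoef

/-- Normalized coefficients of the solution of `f(n+2) = s f(n+1) - q⁻ⁿ β(n+1) f(n)`,
`f(0) = 1`, `f(1) = s`. -/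
noncomputable def ucoef (q : ℝ) (β : ℕ → ℝ) : ℕ → ℕ → ℝ
  | 0, i => if i = 0 then 1 else 0
  | 1, i => if i = 0 then 1 else 0
  | n + 2, 0 => ucoef q β (n + 1) 0
  | n + 2, i + 1 => q ^ (i + 1) * ucoef q β (n + 1) (i + 1) +
      q ^ (2 * (i + 1)) * β (n + 1) * ucoef q β n i

/-- The `q`-Pochhammer symbol `(q; q)ᵢ`. -/
noncomputable def qpoch (q : ℝ) (i : ℕ) : ℝ := ∏ k ∈ Finset.range i, (1 - q ^ (k + 1))

/-- The limits of `ucoef` when `β → 1`. -/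
noncomputable def vcoef (q : ℝ) (i : ℕ) : ℝ := q ^ (i * (i + 1)) / qpoch q i

variable {q : ℝ} {β : ℕ → ℝ}

lemma ucoef_zero_right (n : ℕ) : ucoef q β n 0 = 1 := by
  induction n using Nat.twoStepInduction with
  | zero => simp [ucoef]
  | one => simp [ucoef]
  | more n _ ih => rw [ucoef, ih]

lemma ucoef_eq_zero : ∀ (n i : ℕ), n < 2 * i → ucoef q β n i = 0 := by
  intro n
  induction n using Nat.twoStepInduction with
  | zero => intro i hi; simp [ucoef]; omega
  | one => intro i hi; simp [ucoef]; omega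
  | more n ih1 ih2 =>
    intro i hi
    rcases i with _ | i
    · omega
    · rw [ucoef, ih1 _ (by omega), ih2 _ (by omega)]
      simp

lemma qpoch_succ (i : ℕ) : qpoch q (i + 1) = qpoch q i * (1 - q ^ (i + 1)) :=
  Finset.prod_range_succ _ _

lemma qpoch_pos (hq0 : 0 < q) (hq1 : q < 1) (i : ℕ) : 0 < qpoch q i :=
  Finset.prod_pos fun k _ => sub_pos.mpr (pow_lt_one₀ hq0.le hq1 (by omega))

lemma exists_le_qpoch (hq0 : 0 < q) (hq1 : q < 1) : ∃ c : ℝ, 0 < c ∧ ∀ i, c ≤ qpoch q i := by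
  refine ⟨Real.exp (-((1 - q)⁻¹ * (1 - q)⁻¹)), Real.exp_pos _, fun i => ?_⟩
  have h1 : 0 < 1 - q := by linarith
  calc Real.exp (-((1 - q)⁻¹ * (1 - q)⁻¹))
      ≤ Real.exp (∑ k ∈ Finset.range i, -((1 - q)⁻¹ * q ^ k)) := by
        rw [Real.exp_le_exp, Finset.sum_neg_distrib, neg_le_neg_iff, ← Finset.mul_sum]
        gcongr
        rw [← tsum_geometric_of_lt_one hq0.le hq1]
        exact (summable_geometric_of_lt_one hq0.le hq1).sum_le_tsum _ fun k _ => by positivity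
    _ = ∏ k ∈ Finset.range i, Real.exp (-((1 - q)⁻¹ * q ^ k)) := Real.exp_sum _ _
    _ ≤ qpoch q i := by
        refine Finset.prod_le_prod (fun k _ => (Real.exp_pos _).le) fun k _ => ?_
        have hk : q ^ (k + 1) ≤ q := pow_le_of_le_one hq0.le hq1.le (by omega)
        have hk1 : 0 < 1 - q ^ (k + 1) := by linarith
        have hk2 : q ^ (k + 1) ≤ q ^ k := pow_le_pow_of_le_one hq0.le hq1.le (by omega)
        rw [Real.exp_neg, inv_le_comm₀ (Real.exp_pos _) hk1]
        refine le_trans ?_ (Real.add_one_le_exp _)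
        have h2 : (1 - q ^ (k + 1))⁻¹ = (1 - q ^ (k + 1))⁻¹ * q ^ (k + 1) + 1 := by
          field_simp; ring
        rw [h2]
        gcongr

lemma vcoef_zero : vcoef q 0 = 1 := by simp [vcoef, qpoch]

lemma vcoef_pos (hq0 : 0 < q) (hq1 : q < 1) (i : ℕ) : 0 < vcoef q i :=
  div_pos (by positivity) (qpoch_pos hq0 hq1 i)

lemma vcoef_succ (hq0 : 0 < q) (hq1 : q < 1) (i : ℕ) :
    vcoef q (i + 1) = q ^ (i + 1) * vcoef q (i + 1) + q ^ (2 * (i + 1)) * vcoef q i := by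
  have h := (qpoch_pos hq0 hq1 i).ne'
  have h1 : 1 - q ^ (i + 1) ≠ 0 := (sub_pos.mpr (pow_lt_one₀ hq0.le hq1 (by omega))).ne'
  simp only [vcoef, qpoch_succ]
  field_simp
  ring

lemma exists_vcoef_le (hq0 : 0 < q) (hq1 : q < 1) :
    ∃ c : ℝ, 0 < c ∧ ∀ i, vcoef q i ≤ c * q ^ (i * (i + 1)) := by
  obtain ⟨c, hc, h⟩ := exists_le_qpoch hq0 hq1
  refine ⟨c⁻¹, inv_pos.mpr hc, fun i => ?_⟩
  rw [vcoef, div_eq_inv_mul]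
  gcongr
  exact h i

lemma ucoef_nonneg (hq0 : 0 < q) (h0 : ∀ n, 0 ≤ β n) (n : ℕ) : ∀ i, 0 ≤ ucoef q β n i := by
  induction n using Nat.twoStepInduction with
  | zero => intro i; simp only [ucoef]; split_ifs <;> norm_num
  | one => intro i; simp only [ucoef]; split_ifs <;> norm_num
  | more n ih1 ih2 =>
    intro i
    rcases i with _ | i
    · rw [ucoef]; exact ih2 _
    · rw [ucoef]
      have := ih1 i
      have := ih2 (i + 1)
      have := h0 (n + 1)
      positivity

lemma ucoef_le_vcoef (hq0 : 0 < q) (hq1 : q < 1) (h0 : ∀ n, 0 ≤ β n) (h1 : ∀ n, β n ≤ 1) (n : ℕ) :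
    ∀ i, ucoef q β n i ≤ vcoef q i := by
  have hbase : ∀ i : ℕ, (if i = 0 then (1 : ℝ) else 0) ≤ vcoef q i := by
    intro i
    split_ifs with h
    · rw [h, vcoef_zero]
    · exact (vcoef_pos hq0 hq1 i).le
  induction n using Nat.twoStepInduction with
  | zero => exact hbase
  | one => exact hbase
  | more n ih1 ih2 =>
    intro i
    rcases i with _ | i
    · rw [ucoef]; exact ih2 _
    · rw [ucoef, vcoef_succ hq0 hq1]
      have e1 := ih1 i
      have e2 := ih2 (i + 1)
      have e3 := vcoef_pos hq0 hq1 i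
      have e4 := ucoef_nonneg hq0 h0 n i
      have e5 : β (n + 1) * ucoef q β n i ≤ 1 * vcoef q i := mul_le_mul (h1 _) e1 e4 zero_le_one
      rw [mul_assoc]
      gcongr
      linarith

variable {K : Type*} [Field K] (φ : ℝ →+* K)

/-- The generating polynomial of `ucoef`, with alternating signs. -/
noncomputable def usum (q : ℝ) (β : ℕ → ℝ) (φ : ℝ →+* K) (n : ℕ) (y : K) : K :=
  ∑ i ∈ Finset.range (n + 1), (-1) ^ i * φ (ucoef q β n i) * y ^ i

lemma usum_add_two (n : ℕ) (y : K) : usum q β φ (n + 2) y =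
    usum q β φ (n + 1) (φ q * y) - φ q ^ 2 * y * φ (β (n + 1)) * usum q β φ n (φ q ^ 2 * y) := by
  have h1 : usum q β φ (n + 1) (φ q * y) = ∑ i ∈ Finset.range (n + 3),
      (-1) ^ i * φ (ucoef q β (n + 1) i) * (φ q * y) ^ i := by
    rw [Finset.sum_range_succ _ (n + 2), ucoef_eq_zero _ (n + 2) (by omega)]
    simp [usum]
  have h2 : usum q β φ n (φ q ^ 2 * y) = ∑ i ∈ Finset.range (n + 2),
      (-1) ^ i * φ (ucoef q β n i) * (φ q ^ 2 * y) ^ i := by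
    rw [Finset.sum_range_succ _ (n + 1), ucoef_eq_zero _ (n + 1) (by omega)]
    simp [usum]
  rw [h1, h2, usum, Finset.sum_range_succ', Finset.sum_range_succ' _ (n + 2), Finset.mul_sum,
    add_sub_right_comm, ← Finset.sum_sub_distrib, ucoef, ucoef_zero_right]
  simp only [ucoef, map_add, map_mul, map_pow, pow_zero, mul_one]
  congr 1
  refine Finset.sum_congr rfl fun i _ => ?_
  ring

/-- Solutions of the three-term recurrence in terms of `usum`. -/
lemma recurrence_eq_usum (hq0 : q ≠ 0) {s : K} (hs : s ≠ 0) {f : ℕ → K} (f0 : f 0 = 1)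
    (f1 : f 1 = s) (hf : ∀ n, f (n + 2) = s * f (n + 1) - φ (q⁻¹ ^ n * β (n + 1)) * f n) (n : ℕ) :
    f n = s ^ n * usum q β φ n ((φ q)⁻¹ ^ n * s⁻¹ ^ 2) := by
  have hφ : φ q ≠ 0 := by simpa using hq0
  induction n using Nat.twoStepInduction with
  | zero => simp [f0, usum, ucoef]
  | one => simp [f1, usum, ucoef]
  | more n ih1 ih2 =>
    have hz : φ q * (φ q)⁻¹ = 1 := mul_inv_cancel₀ hφ
    have hs' : s * s⁻¹ = 1 := mul_inv_cancel₀ hs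
    rw [hf, usum_add_two, map_mul, map_pow, map_inv₀]
    set z := (φ q)⁻¹
    have e1 : φ q * (z ^ (n + 2) * s⁻¹ ^ 2) = z ^ (n + 1) * s⁻¹ ^ 2 := by
      linear_combination z ^ (n + 1) * s⁻¹ ^ 2 * hz
    have e2 : φ q ^ 2 * (z ^ (n + 2) * s⁻¹ ^ 2) = z ^ n * s⁻¹ ^ 2 := by
      linear_combination z ^ n * s⁻¹ ^ 2 * (φ q * z + 1) * hz
    rw [e1, e2, ih1, ih2]
    linear_combination z ^ n * φ (β (n + 1)) * s ^ n * usum q β φ n (z ^ n * s⁻¹ ^ 2) *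
      (s * s⁻¹ + 1) * hs'

end Ucoef

section StieltjesWigert

variable {q : ℝ}

/-- Normalized recurrence coefficients of the symmetrized Stieltjes–Wigert polynomials. -/
noncomputable def swBeta (q : ℝ) (n : ℕ) : ℝ := if Even n then 1 - q ^ (n / 2) else 1

/-- The symmetrized Stieltjes–Wigert polynomials. -/
noncomputable def swPoly (q : ℝ) : ℕ → ℝ[X]
  | 0 => 1
  | 1 => X
  | n + 2 => X * swPoly q (n + 1) - C (q⁻¹ ^ n * swBeta q (n + 1)) * swPoly q n

lemma swBeta_nonneg (hq0 : 0 < q) (hq1 : q < 1) (n : ℕ) : 0 ≤ swBeta q n := by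
  unfold swBeta
  split_ifs
  · exact sub_nonneg.mpr (pow_le_one₀ hq0.le hq1.le)
  · exact zero_le_one

lemma swBeta_le_one (hq0 : 0 < q) (n : ℕ) : swBeta q n ≤ 1 := by
  unfold swBeta
  split_ifs
  · have : 0 < q ^ (n / 2) := by positivity
    linarith
  · exact le_rfl

lemma monic_natDegree_swPoly (n : ℕ) : (swPoly q n).Monic ∧ (swPoly q n).natDegree = n := by
  induction n using Nat.twoStepInduction with
  | zero => simp [swPoly]
  | one => simp [swPoly]
  | more n ih1 ih2 =>
    have hd : (X * swPoly q (n + 1)).natDegree = n + 2 := by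
      rw [natDegree_X_mul ih2.1.ne_zero, ih2.2]
    have hlt : (C (q⁻¹ ^ n * swBeta q (n + 1)) * swPoly q n).natDegree <
        (X * swPoly q (n + 1)).natDegree := by
      rw [hd]
      exact (natDegree_C_mul_le _ _).trans_lt (by rw [ih1.2]; omega)
    rw [swPoly]
    refine ⟨(monic_X.mul ih2.1).sub_of_left (degree_lt_degree hlt), ?_⟩
    rw [natDegree_sub_eq_left_of_natDegree_lt hlt, hd]

lemma swPoly_comp_neg (n : ℕ) : (swPoly q n).comp (-X) = (-1) ^ n * swPoly q n := by
  induction n using Nat.twoStepInduction with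
  | zero => simp [swPoly]
  | one => simp [swPoly]
  | more n ih1 ih2 =>
    rw [swPoly, sub_comp, mul_comp, mul_comp, ih1, ih2, X_comp, C_comp]
    ring

/-- The Gaussian moments `q^{-n(n-1)/2}`. -/
noncomputable def tau (q : ℝ) (n : ℕ) : ℝ := ∏ i ∈ Finset.range n, q⁻¹ ^ i

lemma tau_succ (n : ℕ) : tau q (n + 1) = tau q n * q⁻¹ ^ n := Finset.prod_range_succ _ _

lemma tau_pos (hq0 : 0 < q) (n : ℕ) : 0 < tau q n := Finset.prod_pos fun i _ => by positivity

/-- The functional of the Gaussian lattice weight. -/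
noncomputable def gaussFunctional (hq0 : 0 < q) (hq1 : q < 1) : ℝ[X] →ₗ[ℝ] ℝ :=
  latticeFunctional q (gaussWeight q) (summable_gaussWeight hq0 hq1)

lemma gaussFunctional_X_pow_even (hq0 : 0 < q) (hq1 : q < 1) (s : ℕ) :
    gaussFunctional hq0 hq1 (X ^ (2 * s)) =
      2 * (qweight q 1 * (qprod q (q ^ 4))⁻¹) * ∑' k : ℤ, q ^ (2 * k ^ 2 - k + 2 * k * s) := by
  rw [gaussFunctional, latticeFunctional_apply, ← tsum_mul_left]
  congr 1
  ext k
  simp only [eval_pow, eval_X, Even.neg_pow (even_two_mul s), gaussWeight]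
  rw [zpow_add₀ hq0.ne', show (2 * k * s : ℤ) = k * ((2 * s : ℕ) : ℤ) by push_cast; ring, zpow_mul,
    zpow_natCast]
  ring

lemma gaussFunctional_one_pos (hq0 : 0 < q) (hq1 : q < 1) : 0 < gaussFunctional hq0 hq1 1 := by
  rw [gaussFunctional, latticeFunctional_apply]
  have h := summable_eval_add_mul (summable_gaussWeight hq0 hq1) 1
  have h1 := gaussWeight_pos hq0 hq1
  refine h.tsum_pos (fun k => ?_) 0 ?_
  · have := h1 k
    simp only [eval_one]
    positivity
  · have := h1 0
    simp only [eval_one]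
    positivity

lemma gaussFunctional_moment (hq0 : 0 < q) (hq1 : q < 1) (s : ℕ) :
    gaussFunctional hq0 hq1 (X ^ (2 * s)) = gaussFunctional hq0 hq1 1 * tau q s := by
  have h0 : gaussFunctional hq0 hq1 1 = gaussFunctional hq0 hq1 (X ^ (2 * 0)) := by simp
  rw [h0]
  induction s using Nat.twoStepInduction with
  | zero => simp [tau]
  | one =>
    rw [gaussFunctional_X_pow_even, gaussFunctional_X_pow_even, ← (Equiv.neg ℤ).tsum_eq]
    simp only [Equiv.neg_apply, tau, Finset.prod_range_one, pow_zero, mul_one]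
    congr 1
    congr 1
    ext k
    congr 1
    push_cast
    ring
  | more s ih _ =>
    have h1 : gaussFunctional hq0 hq1 (X ^ (2 * s)) =
        q ^ (2 * s + 1) * gaussFunctional hq0 hq1 (X ^ (2 * (s + 2))) := by
      rw [gaussFunctional_X_pow_even, gaussFunctional_X_pow_even,
        ← (Equiv.addRight (1 : ℤ)).tsum_eq, mul_left_comm (q ^ (2 * s + 1)), ← tsum_mul_left (a := q ^ (2 * s + 1))]
      congr 1
      congr 1
      ext k
      rw [← zpow_natCast q (2 * s + 1), ← zpow_add₀ hq0.ne']
      simp only [Equiv.coe_addRight]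
      congr 1
      push_cast
      ring
    have h2 : tau q (s + 2) * q ^ (2 * s + 1) = tau q s := by
      have hz : q * q⁻¹ = 1 := mul_inv_cancel₀ hq0.ne'
      have hz2 : (q * q⁻¹) ^ (2 * s + 1) = 1 := by rw [hz, one_pow]
      rw [tau_succ, tau_succ]
      rw [mul_pow] at hz2
      linear_combination tau q s * hz2
    have h3 : q ^ (2 * s + 1) ≠ 0 := by positivity
    refine mul_left_cancel₀ h3 ?_
    rw [← h1, ih, ← h2]
    ring

lemma gaussFunctional_odd (hq0 : 0 < q) (hq1 : q < 1) {n j : ℕ} (h : Odd (n + j)) :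
    gaussFunctional hq0 hq1 (swPoly q n * X ^ j) = 0 := by
  have h1 := latticeFunctional_comp_neg (summable_gaussWeight hq0 hq1) (swPoly q n * X ^ j)
  rw [mul_comp, swPoly_comp_neg, X_pow_comp, neg_pow (X : ℝ[X]) j,
    show (-1 : ℝ[X]) ^ n * swPoly q n * ((-1) ^ j * X ^ j) = (-1) ^ (n + j) * (swPoly q n * X ^ j) by
      ring, h.neg_one_pow, neg_one_mul, map_neg] at h1
  rw [gaussFunctional]
  linarith

/-- The factor `∏_{r<m} (1 - q^{s-r})`. -/
noncomputable def qfall (q : ℝ) (m s : ℕ) : ℝ := ∏ r ∈ Finset.range m, (1 - q ^ s * q⁻¹ ^ r)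

lemma qfall_succ_succ (hq0 : 0 < q) (m s : ℕ) :
    qfall q (m + 1) (s + 1) = (1 - q ^ (s + 1)) * qfall q m s := by
  rw [qfall, Finset.prod_range_succ', mul_comm, pow_zero, mul_one, qfall]
  congr 1
  refine Finset.prod_congr rfl fun r _ => ?_
  have hz : q * q⁻¹ = 1 := mul_inv_cancel₀ hq0.ne'
  linear_combination -q ^ s * q⁻¹ ^ r * hz

lemma qfall_succ (m s : ℕ) : qfall q (m + 1) s = qfall q m s * (1 - q ^ s * q⁻¹ ^ m) :=
  Finset.prod_range_succ _ _

lemma qfall_self (hq0 : 0 < q) (m : ℕ) : qfall q m m = qpoch q m := by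
  induction m with
  | zero => simp [qfall, qpoch]
  | succ m ih => rw [qfall_succ_succ hq0, qpoch_succ, ih, mul_comm]

lemma qfall_eq_zero (hq0 : 0 < q) {m s : ℕ} (h : s < m) : qfall q m s = 0 := by
  refine Finset.prod_eq_zero (Finset.mem_range.mpr h) ?_
  rw [← mul_pow, mul_inv_cancel₀ hq0.ne', one_pow, sub_self]

lemma gaussFunctional_swPoly (hq0 : 0 < q) (hq1 : q < 1) (m : ℕ) : ∀ s : ℕ,
    gaussFunctional hq0 hq1 (swPoly q (2 * m) * X ^ (2 * s)) =
      gaussFunctional hq0 hq1 1 * tau q (m + s) * qfall q m s ∧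
    gaussFunctional hq0 hq1 (swPoly q (2 * m + 1) * X ^ (2 * s + 1)) =
      gaussFunctional hq0 hq1 1 * tau q (m + s + 1) * qfall q m s := by
  have hrec : ∀ n j : ℕ, gaussFunctional hq0 hq1 (swPoly q (n + 2) * X ^ j) =
      gaussFunctional hq0 hq1 (swPoly q (n + 1) * X ^ (j + 1)) -
      q⁻¹ ^ n * swBeta q (n + 1) * gaussFunctional hq0 hq1 (swPoly q n * X ^ j) := by
    intro n j
    rw [swPoly, ← smul_eq_mul (a := q⁻¹ ^ n * swBeta q (n + 1)), ← map_smul, ← map_sub,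
      smul_eq_C_mul]
    congr 1
    ring
  have hz : q * q⁻¹ = 1 := mul_inv_cancel₀ hq0.ne'
  induction m with
  | zero =>
    intro s
    have e : swPoly q (2 * 0 + 1) * X ^ (2 * s + 1) = X ^ (2 * (s + 1)) := by
      simp only [swPoly]
      ring
    refine ⟨?_, ?_⟩
    · rw [mul_zero, swPoly, one_mul, gaussFunctional_moment]
      simp [qfall]
    · rw [e, gaussFunctional_moment]
      simp [qfall]
  | succ m ih =>
    have hE : ∀ s : ℕ, gaussFunctional hq0 hq1 (swPoly q (2 * m + 2) * X ^ (2 * s)) =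
        gaussFunctional hq0 hq1 1 * tau q (m + s + 1) * qfall q (m + 1) s := by
      intro s
      have hb : swBeta q (2 * m + 1) = 1 := if_neg (by simp)
      have hz3 : (q * q⁻¹) ^ s = 1 := by rw [hz, one_pow]
      rw [mul_pow] at hz3
      rw [hrec, (ih s).1, (ih s).2, hb, qfall_succ, tau_succ]
      linear_combination gaussFunctional hq0 hq1 1 * tau q (m + s) * qfall q m s *
        q⁻¹ ^ (2 * m) * hz3
    intro s
    refine ⟨by rw [mul_add, hE s, add_right_comm], ?_⟩
    have hb : swBeta q (2 * m + 1 + 1) = 1 - q ^ (m + 1) := by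
      rw [swBeta, if_pos ⟨m + 1, by ring⟩]
      congr 2
      omega
    have hz2 : (q * q⁻¹) ^ s = 1 := by rw [hz, one_pow]
    have hz3 : (q * q⁻¹) ^ (m + 1) = 1 := by rw [hz, one_pow]
    have hz4 : (q * q⁻¹) ^ (s + 1) = 1 := by rw [hz, one_pow]
    rw [mul_pow] at hz2 hz3 hz4
    have h1 := hE (s + 1)
    rw [show 2 * (m + 1) + 1 = 2 * m + 1 + 2 by ring, hrec, (ih s).2, hb,
      show 2 * s + 1 + 1 = 2 * (s + 1) by ring, show 2 * m + 1 + 1 = 2 * m + 2 by ring, h1,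
      qfall_succ_succ hq0, qfall_succ, show m + (s + 1) + 1 = m + s + 1 + 1 by ring,
      show m + 1 + s + 1 = m + s + 1 + 1 by ring, tau_succ (m + s + 1)]
    linear_combination gaussFunctional hq0 hq1 1 * tau q (m + s + 1) * qfall q m s *
      (q⁻¹ ^ (2 * m + 1) * hz2 - q⁻¹ ^ m * hz4 + q⁻¹ ^ m * hz3)

end StieltjesWigert

section Norms

variable {q : ℝ}

/-- The norms of the symmetrized Stieltjes–Wigert polynomials. -/
noncomputable def swNorm (hq0 : 0 < q) (hq1 : q < 1) (n : ℕ) : ℝ :=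
  gaussFunctional hq0 hq1 1 * tau q n * qpoch q (n / 2)

lemma swNorm_pos (hq0 : 0 < q) (hq1 : q < 1) (n : ℕ) : 0 < swNorm hq0 hq1 n :=
  mul_pos (mul_pos (gaussFunctional_one_pos hq0 hq1) (tau_pos hq0 n)) (qpoch_pos hq0 hq1 _)

lemma swNorm_succ (hq0 : 0 < q) (hq1 : q < 1) (n : ℕ) :
    swNorm hq0 hq1 (n + 1) = q⁻¹ ^ n * swBeta q (n + 1) * swNorm hq0 hq1 n := by
  rw [swNorm, swNorm, tau_succ, swBeta]
  split_ifs with h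
  · obtain ⟨m, hm⟩ := h
    obtain ⟨m, rfl⟩ : ∃ l, m = l + 1 := ⟨m - 1, by omega⟩
    rw [show (n + 1) / 2 = m + 1 by omega, show n / 2 = m by omega, qpoch_succ]
    ring
  · rw [Nat.not_even_iff] at h
    rw [show (n + 1) / 2 = n / 2 by omega]
    ring

lemma gaussFunctional_swPoly_X_pow (hq0 : 0 < q) (hq1 : q < 1) {n j : ℕ} (h : j ≤ n) :
    gaussFunctional hq0 hq1 (swPoly q n * X ^ j) = if j = n then swNorm hq0 hq1 n else 0 := by
  rcases Nat.even_or_odd (n + j) with ho | ho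
  · rcases Nat.even_or_odd' n with ⟨m, rfl | rfl⟩
    · obtain ⟨s, rfl⟩ : ∃ s, j = 2 * s := ⟨j / 2, by obtain ⟨l, hl⟩ := ho; omega⟩
      rw [(gaussFunctional_swPoly hq0 hq1 m s).1]
      rcases (show s ≤ m by omega).eq_or_lt with rfl | hs
      · rw [if_pos rfl, qfall_self hq0, swNorm, ← two_mul, Nat.mul_div_cancel_left s two_pos]
      · rw [qfall_eq_zero hq0 hs, if_neg (by omega), mul_zero]
    · obtain ⟨s, rfl⟩ : ∃ s, j = 2 * s + 1 := ⟨j / 2, by obtain ⟨l, hl⟩ := ho; omega⟩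
      rw [(gaussFunctional_swPoly hq0 hq1 m s).2]
      rcases (show s ≤ m by omega).eq_or_lt with rfl | hs
      · rw [if_pos rfl, qfall_self hq0, swNorm, ← two_mul, show (2 * s + 1) / 2 = s by omega]
      · rw [qfall_eq_zero hq0 hs, if_neg (by omega), mul_zero]
  · rw [gaussFunctional_odd hq0 hq1 ho, if_neg]
    rintro rfl
    rw [Nat.odd_iff] at ho
    omega

lemma gaussFunctional_swPoly_mul (hq0 : 0 < q) (hq1 : q < 1) {n : ℕ} {p : ℝ[X]}
    (h : p.natDegree ≤ n) :
    gaussFunctional hq0 hq1 (swPoly q n * p) = p.coeff n * swNorm hq0 hq1 n := by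
  conv_lhs => rw [p.as_sum_range_C_mul_X_pow' (Nat.lt_succ_of_le h)]
  rw [Finset.mul_sum, map_sum]
  have h1 : ∀ i ∈ Finset.range n.succ, gaussFunctional hq0 hq1 (swPoly q n * (C (p.coeff i) * X ^ i))
      = if i = n then p.coeff n * swNorm hq0 hq1 n else 0 := by
    intro i hi
    rw [mul_left_comm, ← smul_eq_C_mul, map_smul,
      gaussFunctional_swPoly_X_pow hq0 hq1 (by simpa [Nat.lt_succ_iff] using hi)]
    split_ifs with h
    · rw [h, smul_eq_mul]
    · simp
  rw [Finset.sum_congr rfl h1]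
  simp

lemma latticeFunctional_sq_nonneg {v : ℤ → ℝ}
    (hv : ∀ j : ℕ, Summable fun k : ℤ => (q ^ k) ^ j * v k) (h0 : ∀ k, 0 ≤ v k) (p : ℝ[X]) :
    0 ≤ latticeFunctional q v hv (p * p) := by
  rw [latticeFunctional_apply]
  refine tsum_nonneg fun k => mul_nonneg ?_ (h0 k)
  simp only [eval_mul]
  exact add_nonneg (mul_self_nonneg _) (mul_self_nonneg _)

lemma coeff_swPoly_self (n : ℕ) : (swPoly q n).coeff n = 1 := by
  have := (monic_natDegree_swPoly (q := q) n).1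
  rwa [Monic, leadingCoeff, (monic_natDegree_swPoly n).2] at this

variable (hq0 : 0 < q) (hq1 : q < 1) (F : MonicOrthFamily q 1)

lemma swNorm_le (n : ℕ) : swNorm hq0 hq1 n ≤ F.γ n := by
  set S := F.toQFreudSystem hq0 hq1
  have h1 : S.L (S.P n * S.P n) = F.γ n := by rw [S.orth, if_pos rfl]; rfl
  have h2 : gaussFunctional hq0 hq1 (S.P n * S.P n) ≤ S.L (S.P n * S.P n) := by
    refine Summable.tsum_le_tsum (fun k => ?_)
      (summable_eval_add_mul (summable_gaussWeight hq0 hq1) _)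
      (summable_eval_add_mul (summable_latticeWeight hq0 hq1) _)
    refine mul_le_mul_of_nonneg_left (gaussWeight_le hq0 hq1 k) ?_
    simp only [eval_mul]
    exact add_nonneg (mul_self_nonneg _) (mul_self_nonneg _)
  have h3 := latticeFunctional_sq_nonneg (summable_gaussWeight hq0 hq1)
    (fun k => (gaussWeight_pos hq0 hq1 k).le) (S.P n - swPoly q n)
  have h4 := gaussFunctional_swPoly_mul hq0 hq1 (n := n) (p := S.P n) (S.deg n).le
  have h5 := gaussFunctional_swPoly_mul hq0 hq1 (n := n) (p := swPoly q n)
    (monic_natDegree_swPoly n).2.le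
  rw [S.coeff_self] at h4
  rw [coeff_swPoly_self] at h5
  have h6 : gaussFunctional hq0 hq1 (S.P n * S.P n) =
      2 * gaussFunctional hq0 hq1 (swPoly q n * S.P n) -
      gaussFunctional hq0 hq1 (swPoly q n * swPoly q n) +
      gaussFunctional hq0 hq1 ((S.P n - swPoly q n) * (S.P n - swPoly q n)) := by
    have e : (S.P n - swPoly q n) * (S.P n - swPoly q n) =
      S.P n * S.P n - swPoly q n * S.P n - swPoly q n * S.P n + swPoly q n * swPoly q n := by ring
    rw [e, map_add, map_sub, map_sub]
    ring
  change 0 ≤ gaussFunctional hq0 hq1 _ at h3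
  linarith

lemma norm_le_weightFunctional (n : ℕ) :
    F.γ n ≤ weightFunctional hq0 hq1 (swPoly q n * swPoly q n) := by
  set S := F.toQFreudSystem hq0 hq1
  have h1 : S.L (S.P n * S.P n) = F.γ n := by rw [S.orth, if_pos rfl]; rfl
  have h3 := latticeFunctional_sq_nonneg (summable_latticeWeight hq0 hq1)
    (fun k => (latticeWeight_pos hq0 hq1 k).le) (swPoly q n - S.P n)
  have h4 := S.map_mul_of_natDegree_le (n := n) (p := swPoly q n) (monic_natDegree_swPoly n).2.le
  rw [coeff_swPoly_self, one_mul] at h4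
  have h6 : S.L (swPoly q n * swPoly q n) = 2 * S.L (swPoly q n * S.P n) - S.L (S.P n * S.P n) +
      S.L ((swPoly q n - S.P n) * (swPoly q n - S.P n)) := by
    have e : (swPoly q n - S.P n) * (swPoly q n - S.P n) =
      swPoly q n * swPoly q n - swPoly q n * S.P n - swPoly q n * S.P n + S.P n * S.P n := by ring
    rw [e, map_add, map_sub, map_sub]
    ring
  change 0 ≤ S.L _ at h3
  change F.γ n ≤ S.L (swPoly q n * swPoly q n)
  change S.L _ = F.γ n at h4
  linarith

lemma weightFunctional_le {B : ℝ} {n : ℕ}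
    (hB : ∀ k : ℤ, (swPoly q n).eval (q ^ k) ^ 2 * (latticeWeight q k - gaussWeight q k) ≤
      B * q ^ k.natAbs) :
    weightFunctional hq0 hq1 (swPoly q n * swPoly q n) ≤
      swNorm hq0 hq1 n + 2 * B * ∑' k : ℤ, q ^ k.natAbs := by
  have h5 := gaussFunctional_swPoly_mul hq0 hq1 (n := n) (p := swPoly q n)
    (monic_natDegree_swPoly n).2.le
  rw [coeff_swPoly_self, one_mul] at h5
  have hs := (summable_pow_natAbs hq0 hq1).mul_left (2 * B)
  have hg := summable_eval_add_mul (summable_gaussWeight hq0 hq1) (swPoly q n * swPoly q n)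
  rw [← h5, ← tsum_mul_left, gaussFunctional, latticeFunctional_apply, ← hg.tsum_add hs,
    weightFunctional, latticeFunctional_apply]
  refine Summable.tsum_le_tsum (fun k => ?_)
    (summable_eval_add_mul (summable_latticeWeight hq0 hq1) _) (hg.add hs)
  have hneg : (swPoly q n).eval (-q ^ k) ^ 2 = (swPoly q n).eval (q ^ k) ^ 2 := by
    have := congrArg (eval (q ^ k)) (swPoly_comp_neg (q := q) n)
    simp only [eval_comp, eval_neg, eval_X, eval_mul, eval_pow, eval_one] at this
    rw [this, mul_pow, ← pow_mul, mul_comm n 2, pow_mul]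
    simp
  rw [eval_mul, eval_mul, ← pow_two, ← pow_two, hneg]
  linarith [hB k]

end Norms

section Estimates

variable {q : ℝ}

/-- The exponent of the `i`-th term of `swPoly q n` at `qᵏ`. -/
def swExp (n : ℕ) (k : ℤ) (i : ℕ) : ℤ := i ^ 2 + i - n * i + k * (n - 2 * i)

lemma eval_swPoly (hq0 : 0 < q) (n : ℕ) {x : ℝ} (hx : x ≠ 0) : (swPoly q n).eval x =
    x ^ n * usum q (swBeta q) (RingHom.id ℝ) n (q⁻¹ ^ n * x⁻¹ ^ 2) := by
  refine recurrence_eq_usum (RingHom.id ℝ) hq0.ne' (f := fun n => (swPoly q n).eval x) hx ?_ ?_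
    (fun n => ?_) n
  · simp [swPoly]
  · simp [swPoly]
  · simp only [swPoly, eval_sub, eval_mul, eval_X, eval_C, RingHom.id_apply]

lemma exists_eval_swPoly_sq_le (hq0 : 0 < q) (hq1 : q < 1) : ∃ c : ℝ, 0 < c ∧ ∀ (n : ℕ) (k : ℤ),
    (swPoly q n).eval (q ^ k) ^ 2 ≤
      c * (n + 1) * ∑ i ∈ Finset.range (n + 1), if 2 * i ≤ n then q ^ (2 * swExp n k i) else 0 := by
  obtain ⟨c, hc, hv⟩ := exists_vcoef_le hq0 hq1
  refine ⟨c ^ 2, by positivity, fun n k => ?_⟩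
  have hk := zpow_pos hq0 k
  have hterm : ∀ i : ℕ, (q ^ k) ^ n * (c * q ^ (i * (i + 1)) * (q⁻¹ ^ n * (q ^ k)⁻¹ ^ 2) ^ i) =
      c * q ^ swExp n k i := by
    intro i
    rw [mul_left_comm, mul_assoc]
    congr 1
    simp only [← zpow_natCast, ← zpow_neg_one, ← zpow_mul, ← zpow_add₀ hq0.ne', swExp]
    congr 1
    push_cast
    ring
  have h1 : |(swPoly q n).eval (q ^ k)| ≤
      c * ∑ i ∈ Finset.range (n + 1), if 2 * i ≤ n then q ^ swExp n k i else 0 := by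
    rw [eval_swPoly hq0 n hk.ne', usum, Finset.mul_sum, Finset.mul_sum]
    refine (Finset.abs_sum_le_sum_abs _ _).trans (Finset.sum_le_sum fun i _ => ?_)
    split_ifs with hi
    · rw [← hterm, abs_mul, abs_mul, abs_mul, abs_neg_one_pow, one_mul, abs_of_pos (pow_pos hk n),
        RingHom.id_apply,
        abs_of_nonneg (ucoef_nonneg hq0 (swBeta_nonneg hq0 hq1) n i), abs_of_nonneg (by positivity)]
      gcongr
      exact (ucoef_le_vcoef hq0 hq1 (swBeta_nonneg hq0 hq1) (swBeta_le_one hq0) n i).trans (hv i)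
    · rw [ucoef_eq_zero n i (by omega)]
      simp
  have h2 := sq_sum_le_card_mul_sum_sq (s := Finset.range (n + 1))
    (f := fun i => if 2 * i ≤ n then q ^ swExp n k i else 0)
  have h3 : ∀ i, (if 2 * i ≤ n then q ^ swExp n k i else 0) ^ 2 =
      if 2 * i ≤ n then q ^ (2 * swExp n k i) else 0 := by
    intro i
    split_ifs
    · rw [← zpow_natCast, ← zpow_mul, mul_comm]
      rfl
    · simp
  simp only [h3, Finset.card_range] at h2
  push_cast at h2
  rw [← sq_abs]
  calc _ ≤ (c * ∑ i ∈ Finset.range (n + 1), if 2 * i ≤ n then q ^ swExp n k i else 0) ^ 2 := by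
        gcongr
    _ ≤ _ := by
        rw [mul_pow, mul_assoc]
        gcongr

lemma exists_weight_error_le (hq0 : 0 < q) (hq1 : q < 1) :
    ∃ K : ℝ, 0 < K ∧ ∀ k : ℤ, latticeWeight q k - gaussWeight q k ≤
      K * q ^ (if 0 ≤ k then k else 2 * k ^ 2 - 5 * k) := by
  obtain ⟨K, hK0, hK⟩ := exists_latticeWeight_sub_le hq0 hq1
  have hc := gaussConst_pos hq0 hq1
  refine ⟨1 + K * (qweight q 1 * (qprod q (q ^ 4))⁻¹), by positivity, fun k => ?_⟩
  split_ifs with h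
  · have h1 := latticeWeight_le hq0 hq1 k
    have h2 := gaussWeight_pos hq0 hq1 k
    have h3 : 0 ≤ K * (qweight q 1 * (qprod q (q ^ 4))⁻¹) * q ^ k := by positivity
    linarith
  · have h1 := hK k (by omega)
    have h2 : q ^ (-(4 * k)) * q ^ (2 * k ^ 2 - k) = q ^ (2 * k ^ 2 - 5 * k) := by
      rw [← zpow_add₀ hq0.ne']
      congr 1
      ring
    have h3 := zpow_pos hq0 (2 * k ^ 2 - 5 * k)
    rw [gaussWeight] at h1 ⊢
    calc _ ≤ _ := h1
      _ = K * (qweight q 1 * (qprod q (q ^ 4))⁻¹) * q ^ (2 * k ^ 2 - 5 * k) := by rw [← h2]; ring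
      _ ≤ _ := by nlinarith

lemma swExp_bound (n i : ℕ) (k : ℤ) (hi : 2 * i ≤ n) :
    -2 * ((n : ℤ) - 1) ^ 2 + 4 * k.natAbs ≤
      4 * (2 * swExp n k i + if 0 ≤ k then k else 2 * k ^ 2 - 5 * k) := by
  have hi' : (2 * i : ℤ) ≤ n := by exact_mod_cast hi
  unfold swExp
  split_ifs with h
  · rw [Int.natAbs_of_nonneg h]
    nlinarith [mul_nonneg h (sub_nonneg.mpr hi'), sq_nonneg (2 * (i : ℤ) - n + 1)]
  · rw [Int.ofNat_natAbs_of_nonpos (by omega)]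
    nlinarith [sq_nonneg (2 * ((i : ℤ) - k) - n + 1)]

lemma tau_eq {ρ : ℝ} (hρ : 0 < ρ) (n : ℕ) :
    tau (ρ ^ 4) n = ρ ^ (-2 * (n : ℤ) * (n - 1)) := by
  induction n with
  | zero => simp [tau]
  | succ n ih =>
    rw [tau_succ, ih, ← zpow_natCast, ← zpow_neg_one, ← zpow_natCast, ← zpow_mul, ← zpow_mul,
      ← zpow_add₀ hρ.ne']
    congr 1
    push_cast
    ring

variable {ρ : ℝ}

lemma exists_swPoly_error_le (hρ : 0 < ρ) (hρ1 : ρ < 1) (hq : q = ρ ^ 4) : ∃ K : ℝ, 0 < K ∧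
    ∀ (n : ℕ) (k : ℤ), (swPoly q n).eval (q ^ k) ^ 2 * (latticeWeight q k - gaussWeight q k) ≤
      K * (n + 1) ^ 2 * tau q n * ρ ^ (2 * n) * q ^ k.natAbs := by
  have hq0 : 0 < q := by rw [hq]; positivity
  have hq1 : q < 1 := by rw [hq]; exact pow_lt_one₀ hρ.le hρ1 (by norm_num)
  obtain ⟨c, hc, h1⟩ := exists_eval_swPoly_sq_le hq0 hq1
  obtain ⟨K, hK, h2⟩ := exists_weight_error_le hq0 hq1
  refine ⟨c * K * ρ⁻¹ ^ 2, by positivity, fun n k => ?_⟩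
  have hB : ∀ i, (if 2 * i ≤ n then q ^ (2 * swExp n k i) else 0) *
      q ^ (if 0 ≤ k then k else 2 * k ^ 2 - 5 * k) ≤
      ρ⁻¹ ^ 2 * tau q n * ρ ^ (2 * n) * q ^ k.natAbs := by
    intro i
    have hpos : 0 ≤ ρ⁻¹ ^ 2 * tau q n * ρ ^ (2 * n) * q ^ k.natAbs := by
      have := tau_pos hq0 n
      positivity
    split_ifs with hi hk hk
    on_goal 3 => simpa using hpos
    on_goal 3 => simpa using hpos
    all_goals
      have h := swExp_bound n i k hi
      simp only [hk, if_true, if_false] at h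
      have e : ρ⁻¹ ^ 2 * tau q n * ρ ^ (2 * n) * q ^ k.natAbs =
          ρ ^ (-2 * ((n : ℤ) - 1) ^ 2 + 4 * k.natAbs) := by
        rw [hq, tau_eq hρ]
        simp only [← zpow_natCast, ← zpow_neg_one, ← zpow_mul, ← zpow_add₀ hρ.ne']
        congr 1
        push_cast
        ring
      rw [← zpow_add₀ hq0.ne', e, hq, ← zpow_natCast ρ 4, ← zpow_mul]
      exact zpow_le_of_le hρ hρ1 h
  calc _ ≤ (c * (n + 1) * ∑ i ∈ Finset.range (n + 1),
        if 2 * i ≤ n then q ^ (2 * swExp n k i) else 0) *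
        (K * q ^ (if 0 ≤ k then k else 2 * k ^ 2 - 5 * k)) := by
        refine mul_le_mul (h1 n k) (h2 k) (sub_nonneg.mpr (gaussWeight_le hq0 hq1 k)) ?_
        exact (sq_nonneg _).trans (h1 n k)
    _ = c * (n + 1) * K * ∑ i ∈ Finset.range (n + 1),
        (if 2 * i ≤ n then q ^ (2 * swExp n k i) else 0) *
          q ^ (if 0 ≤ k then k else 2 * k ^ 2 - 5 * k) := by
        rw [← Finset.sum_mul]
        ring
    _ ≤ c * (n + 1) * K * ∑ i ∈ Finset.range (n + 1),
        (ρ⁻¹ ^ 2 * tau q n * ρ ^ (2 * n) * q ^ k.natAbs) :=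
        mul_le_mul_of_nonneg_left (Finset.sum_le_sum fun i _ => hB i) (by positivity)
    _ = _ := by
        rw [Finset.sum_const, Finset.card_range, nsmul_eq_mul]
        push_cast
        ring

lemma exists_sq_mul_pow_le (hρ : 0 < ρ) (hρ1 : ρ < 1) :
    ∃ K : ℝ, 0 < K ∧ ∀ n : ℕ, ((n : ℝ) + 1) ^ 2 * ρ ^ (2 * n) ≤ K * ρ ^ n := by
  have h := (tendsto_pow_const_mul_const_pow_of_abs_lt_one 2
    (by rwa [abs_of_pos hρ] : |ρ| < 1)).comp (Filter.tendsto_add_atTop_nat 1)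
  obtain ⟨K, hK⟩ := h.bddAbove_range
  refine ⟨max K 1 * ρ⁻¹, by positivity, fun n => ?_⟩
  have h1 : ((n + 1 : ℕ) : ℝ) ^ 2 * ρ ^ (n + 1) ≤ K := hK ⟨n, rfl⟩
  push_cast at h1
  calc ((n : ℝ) + 1) ^ 2 * ρ ^ (2 * n) = ((n + 1) ^ 2 * ρ ^ (n + 1)) * ρ⁻¹ * ρ ^ n := by
        field_simp
        ring
    _ ≤ max K 1 * ρ⁻¹ * ρ ^ n := by
        gcongr
        exact h1.trans (le_max_left _ _)

lemma exists_norm_le (hρ : 0 < ρ) (hρ1 : ρ < 1) (hq : q = ρ ^ 4) (hq0 : 0 < q) (hq1 : q < 1)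
    (F : MonicOrthFamily q 1) :
    ∃ K : ℝ, 0 < K ∧ ∀ n, F.γ n ≤ swNorm hq0 hq1 n * (1 + K * ρ ^ n) := by
  obtain ⟨K, hK, h1⟩ := exists_swPoly_error_le hρ hρ1 hq
  obtain ⟨K', hK', h2⟩ := exists_sq_mul_pow_le hρ hρ1
  obtain ⟨c, hc, h3⟩ := exists_le_qpoch hq0 hq1
  have hM := gaussFunctional_one_pos hq0 hq1
  set M := gaussFunctional hq0 hq1 1
  set Z := ∑' k : ℤ, q ^ k.natAbs
  have hZ : 0 ≤ Z := tsum_nonneg fun k => by positivity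
  refine ⟨2 * K * K' * Z / (M * c) + 1, by positivity, fun n => ?_⟩
  have h4 := (norm_le_weightFunctional hq0 hq1 F n).trans (weightFunctional_le hq0 hq1 (h1 n))
  have hτ := tau_pos hq0 n
  have hp := (swNorm_pos hq0 hq1 n).le
  have h5 : M * tau q n * c ≤ swNorm hq0 hq1 n := by
    rw [swNorm]
    gcongr
    exact h3 _
  calc F.γ n ≤ _ := h4
    _ = swNorm hq0 hq1 n + 2 * K * tau q n * Z * ((n + 1) ^ 2 * ρ ^ (2 * n)) := by ring
    _ ≤ swNorm hq0 hq1 n + 2 * K * tau q n * Z * (K' * ρ ^ n) := by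
        have := mul_le_mul_of_nonneg_left (h2 n) (by positivity : 0 ≤ 2 * K * tau q n * Z)
        linarith
    _ = swNorm hq0 hq1 n + (M * tau q n * c) * (2 * K * K' * Z / (M * c) * ρ ^ n) := by
        field_simp
    _ ≤ swNorm hq0 hq1 n + swNorm hq0 hq1 n * ((2 * K * K' * Z / (M * c) + 1) * ρ ^ n) := by
        gcongr
        linarith
    _ = _ := by ring

/-- Exponentially fast convergence of the normalized recurrence coefficients. -/
theorem exists_alpha_bound (hρ : 0 < ρ) (hρ1 : ρ < 1) (hq : q = ρ ^ 4) (hq0 : 0 < q) (hq1 : q < 1)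
    (F : MonicOrthFamily q 1) : ∃ K : ℝ, 0 < K ∧ ∀ n : ℕ,
      |q ^ n * (F.toQFreudSystem hq0 hq1).α (n + 1) - 1| ≤ K * ρ ^ n := by
  obtain ⟨K, hK, h1⟩ := exists_norm_le hρ hρ1 hq hq0 hq1 F
  refine ⟨K + 1, by positivity, fun n => ?_⟩
  have hα : (F.toQFreudSystem hq0 hq1).α (n + 1) = F.γ (n + 1) / F.γ n := rfl
  have hs : ∀ n, ∃ d, 0 ≤ d ∧ d ≤ K * ρ ^ n ∧ F.γ n = swNorm hq0 hq1 n * (1 + d) := by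
    intro n
    have hp := swNorm_pos hq0 hq1 n
    refine ⟨F.γ n / swNorm hq0 hq1 n - 1, ?_, ?_, ?_⟩
    · rw [sub_nonneg, one_le_div hp]
      exact swNorm_le hq0 hq1 F n
    · rw [sub_le_iff_le_add', div_le_iff₀' hp]
      exact h1 n
    · field_simp
      ring
  obtain ⟨d, d0, d1, hd⟩ := hs n
  obtain ⟨e, e0, e1, he⟩ := hs (n + 1)
  have hp := swNorm_pos hq0 hq1 n
  have hb0 := swBeta_nonneg hq0 hq1 (n + 1)
  have hb1 := swBeta_le_one hq0 (n + 1)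
  have hb2 : 1 - swBeta q (n + 1) ≤ ρ ^ n := by
    rw [swBeta]
    split_ifs with h
    · rw [hq, ← pow_mul, sub_sub_cancel]
      exact pow_le_pow_of_le_one hρ.le hρ1.le (by omega)
    · rw [sub_self]
      positivity
  have key : q ^ n * (F.toQFreudSystem hq0 hq1).α (n + 1) =
      swBeta q (n + 1) * ((1 + e) / (1 + d)) := by
    rw [hα, hd, he, swNorm_succ, inv_pow]
    field_simp
  have e2 : e ≤ K * ρ ^ n := e1.trans (by
    gcongr ?_ * ?_
    exact pow_le_pow_of_le_one hρ.le hρ1.le (by omega))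
  have hd1 : 0 < 1 + d := by linarith
  have hquot : |(1 + e) / (1 + d) - 1| ≤ K * ρ ^ n := by
    rw [div_sub_one hd1.ne', abs_div, abs_of_pos hd1, div_le_iff₀ hd1, abs_le]
    have : 0 ≤ K * ρ ^ n * d := by positivity
    constructor <;> nlinarith
  rw [key]
  have : swBeta q (n + 1) * ((1 + e) / (1 + d)) - 1 =
      swBeta q (n + 1) * ((1 + e) / (1 + d) - 1) - (1 - swBeta q (n + 1)) := by ring
  rw [this]
  calc _ ≤ |swBeta q (n + 1) * ((1 + e) / (1 + d) - 1)| + |1 - swBeta q (n + 1)| := abs_sub _ _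
    _ ≤ 1 * (K * ρ ^ n) + ρ ^ n := by
        rw [abs_mul, abs_of_nonneg hb0, abs_of_nonneg (by linarith : 0 ≤ 1 - swBeta q (n + 1))]
        gcongr
    _ = _ := by ring

end Estimates

section FarField

variable {q : ℝ}

lemma summable_pow_mul_pow (hq0 : 0 < q) (hq1 : q < 1) (x : ℝ) :
    Summable fun i : ℕ => q ^ (i * (i + 1)) * x ^ i := by
  have h : Filter.Tendsto (fun i : ℕ => q ^ (i + 1) * x) Filter.atTop (𝓝 0) := by
    simpa using ((tendsto_pow_atTop_nhds_zero_of_lt_one hq0.le hq1).comp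
      (Filter.tendsto_add_atTop_nat 1)).mul_const x
  have h2 : ∀ᶠ i : ℕ in Filter.atTop, |q ^ (i + 1) * x| < 1 / 2 := by
    simpa using h.abs.eventually (gt_mem_nhds (by norm_num : |(0 : ℝ)| < 1 / 2))
  refine Summable.of_norm_bounded_eventually_nat summable_geometric_two (h2.mono fun i hi => ?_)
  rw [mul_comm i, pow_mul, ← mul_pow, norm_pow]
  exact pow_le_pow_left₀ (norm_nonneg _) hi.le i

/-- Coefficients of the far-field limit function. -/
noncomputable def farCoef (q : ℝ) (i : ℕ) : ℂ := (-1) ^ i * (vcoef q i : ℂ)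

lemma norm_farCoef_mul_pow (hq0 : 0 < q) (hq1 : q < 1) (i : ℕ) (y : ℂ) :
    ‖farCoef q i * y ^ i‖ = vcoef q i * ‖y‖ ^ i := by
  simp [farCoef, abs_of_pos (vcoef_pos hq0 hq1 i)]

lemma summable_farCoef (hq0 : 0 < q) (hq1 : q < 1) (y : ℂ) :
    Summable fun i => farCoef q i * y ^ i := by
  obtain ⟨c, hc, h⟩ := exists_vcoef_le hq0 hq1
  refine Summable.of_norm_bounded ((summable_pow_mul_pow hq0 hq1 ‖y‖).mul_left c) fun i => ?_
  rw [norm_farCoef_mul_pow hq0 hq1, ← mul_assoc]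
  gcongr
  exact h i

/-- The far-field limit function, in the variable `y = t⁻²`. -/
noncomputable def farSum (q : ℝ) (y : ℂ) : ℂ := ∑' i, farCoef q i * y ^ i

lemma farSum_eq (hq0 : 0 < q) (hq1 : q < 1) (y : ℂ) :
    farSum q y = farSum q (q * y) - q ^ 2 * y * farSum q (q ^ 2 * y) := by
  have h1 := (summable_farCoef hq0 hq1 y)
  have h2 := (summable_farCoef hq0 hq1 (q * y))
  have h3 := (summable_farCoef hq0 hq1 (q ^ 2 * y))
  rw [farSum, farSum, h1.tsum_eq_zero_add, h2.tsum_eq_zero_add, farSum, ← tsum_mul_left,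
    pow_zero, pow_zero, add_sub_assoc]
  congr 1
  rw [← Summable.tsum_sub ((summable_nat_add_iff 1).mpr h2) (h3.mul_left _)]
  refine tsum_congr fun i => ?_
  have h := congrArg Complex.ofReal (vcoef_succ hq0 hq1 i)
  push_cast at h
  simp only [farCoef]
  linear_combination (-1) ^ (i + 1) * y ^ (i + 1) * h

lemma farSum_functional_eq (hq0 : 0 < q) (hq1 : q < 1) (y : ℂ) :
    q ^ 7 * y ^ 2 * farSum q (q ^ 4 * y) - (1 - q ^ 2 * (q + 1) * y) * farSum q (q ^ 2 * y) +
      farSum q y = 0 := by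
  have h1 := farSum_eq hq0 hq1 y
  have h2 := farSum_eq hq0 hq1 (q * y)
  have h3 := farSum_eq hq0 hq1 (q ^ 2 * y)
  rw [show (q : ℂ) * (q * y) = q ^ 2 * y by ring,
    show (q : ℂ) ^ 2 * (q * y) = q ^ 3 * y by ring] at h2
  rw [show (q : ℂ) * (q ^ 2 * y) = q ^ 3 * y by ring,
    show (q : ℂ) ^ 2 * (q ^ 2 * y) = q ^ 4 * y by ring] at h3
  linear_combination h1 + h2 + q ^ 3 * y * h3

variable {ρ : ℝ} {β : ℕ → ℝ}

lemma exists_abs_ucoef_sub_le (hρ : 0 < ρ) (hρ1 : ρ < 1) (hq : q = ρ ^ 4) {K : ℝ} (hK : 0 ≤ K)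
    (hβ : ∀ n, |β (n + 1) - 1| ≤ K * ρ ^ n) : ∃ c D : ℝ, 0 < c ∧ 0 < D ∧ ∀ n i,
      |ucoef q β n i - vcoef q i| ≤ c * D ^ i * q ^ (i * (i + 1)) * ρ ^ n := by
  have hq0 : 0 < q := by rw [hq]; positivity
  have hq1 : q < 1 := by rw [hq]; exact pow_lt_one₀ hρ.le hρ1 (by norm_num)
  obtain ⟨c, hc, hv⟩ := exists_vcoef_le hq0 hq1
  have hgap : 0 < ρ ^ 2 - ρ ^ 5 := sub_pos.mpr (pow_lt_pow_right_of_lt_one₀ hρ hρ1 (by norm_num))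
  obtain ⟨D, hD1, hD⟩ : ∃ D : ℝ, 1 ≤ D ∧ 1 + 2 * K ≤ D * (ρ ^ 2 - ρ ^ 5) := by
    refine ⟨max 1 ((1 + 2 * K) / (ρ ^ 2 - ρ ^ 5)), le_max_left _ _, ?_⟩
    rw [← div_le_iff₀ hgap]
    exact le_max_right _ _
  have hD0 : 0 < D := by linarith
  have hDi : ∀ i, 1 ≤ D ^ i := fun i => one_le_pow₀ hD1
  have hbase : ∀ i, ∀ n ≤ 1, |(if i = 0 then (1 : ℝ) else 0) - vcoef q i| ≤
      c / ρ * D ^ i * q ^ (i * (i + 1)) * ρ ^ n := by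
    intro i n hn
    split_ifs with h
    · rw [h, vcoef_zero, sub_self, abs_zero]
      positivity
    · rw [zero_sub, abs_neg, abs_of_pos (vcoef_pos hq0 hq1 i)]
      calc vcoef q i ≤ c * q ^ (i * (i + 1)) := hv i
        _ = c / ρ * 1 * q ^ (i * (i + 1)) * ρ ^ 1 := by field_simp
        _ ≤ _ := by
          gcongr ?_ * ?_ * _ * ?_
          · exact hDi i
          · exact pow_le_pow_of_le_one hρ.le hρ1.le hn
  refine ⟨c / ρ, D, by positivity, hD0, fun n => ?_⟩
  induction n using Nat.twoStepInduction with
  | zero => exact fun i => hbase i 0 (by norm_num)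
  | one => exact fun i => hbase i 1 le_rfl
  | more n ih1 ih2 =>
    intro i
    rcases i with _ | i
    · rw [ucoef_zero_right, vcoef_zero, sub_self, abs_zero]
      positivity
    · have e1 := ih2 (i + 1)
      have e2 := ih1 i
      have e3 := hβ n
      have e4 : |β (n + 1)| ≤ 1 + K := by
        have : K * ρ ^ n ≤ K * 1 := by
          gcongr
          exact pow_le_one₀ hρ.le hρ1.le
        have := abs_add_le (β (n + 1) - 1) 1
        rw [sub_add_cancel, abs_one] at this
        linarith
      set A := q ^ (i * (i + 1)) with hA
      have hA' : q ^ ((i + 1) * (i + 1 + 1)) = q ^ (2 * (i + 1)) * A := by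
        rw [hA, ← pow_add]
        congr 1
        ring
      have hApos : 0 < A := by positivity
      rw [ucoef, vcoef_succ hq0 hq1]
      have e5 : q ^ (i + 1) * ucoef q β (n + 1) (i + 1) +
          q ^ (2 * (i + 1)) * β (n + 1) * ucoef q β n i -
          (q ^ (i + 1) * vcoef q (i + 1) + q ^ (2 * (i + 1)) * vcoef q i) =
          q ^ (i + 1) * (ucoef q β (n + 1) (i + 1) - vcoef q (i + 1)) + q ^ (2 * (i + 1)) *
          (β (n + 1) * (ucoef q β n i - vcoef q i) + (β (n + 1) - 1) * vcoef q i) := by ring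
      rw [e5]
      have e6 : q ^ (i + 1) ≤ ρ ^ 4 := by
        rw [← hq]
        exact pow_le_of_le_one hq0.le hq1.le (by omega)
      have e7 : |β (n + 1) * (ucoef q β n i - vcoef q i) + (β (n + 1) - 1) * vcoef q i| ≤
          (1 + K) * (c / ρ * D ^ i * A * ρ ^ n) + K * ρ ^ n * (c / ρ * D ^ i * A) := by
        refine (abs_add_le _ _).trans ?_
        rw [abs_mul, abs_mul, abs_of_pos (vcoef_pos hq0 hq1 i)]
        have hvi : vcoef q i ≤ c / ρ * D ^ i * A := by
          calc vcoef q i ≤ c * A := hv i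
            _ = c / 1 * 1 * A := by ring
            _ ≤ c / ρ * D ^ i * A := by
              gcongr
              exact hDi i
        have := (vcoef_pos hq0 hq1 i).le
        gcongr
      calc _ ≤ q ^ (i + 1) * |ucoef q β (n + 1) (i + 1) - vcoef q (i + 1)| + q ^ (2 * (i + 1)) *
            |β (n + 1) * (ucoef q β n i - vcoef q i) + (β (n + 1) - 1) * vcoef q i| := by
            refine (abs_add_le _ _).trans ?_
            rw [abs_mul, abs_mul, abs_of_pos (pow_pos hq0 (i + 1)),
              abs_of_pos (pow_pos hq0 (2 * (i + 1)))]
        _ ≤ ρ ^ 4 * (c / ρ * D ^ (i + 1) * (q ^ (2 * (i + 1)) * A) * ρ ^ (n + 1)) +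
            q ^ (2 * (i + 1)) *
            ((1 + K) * (c / ρ * D ^ i * A * ρ ^ n) + K * ρ ^ n * (c / ρ * D ^ i * A)) := by
            rw [hA'] at e1
            gcongr
        _ = (c / ρ * D ^ i * (q ^ (2 * (i + 1)) * A) * ρ ^ n) *
              (D * ρ ^ 5 + (1 + 2 * K)) := by ring
        _ ≤ (c / ρ * D ^ i * (q ^ (2 * (i + 1)) * A) * ρ ^ n) * (D * ρ ^ 2) := by
            gcongr
            linarith
        _ = _ := by rw [hA']; ring

lemma exists_norm_usum_sub_le (hρ : 0 < ρ) (hρ1 : ρ < 1) (hq : q = ρ ^ 4) {K : ℝ} (hK : 0 ≤ K)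
    (hβ : ∀ n, |β (n + 1) - 1| ≤ K * ρ ^ n) (y : ℂ) : ∃ M : ℝ, 0 < M ∧ ∀ n,
      ‖usum q β Complex.ofRealHom n y - farSum q y‖ ≤ M * ρ ^ n := by
  have hq0 : 0 < q := by rw [hq]; positivity
  have hq1 : q < 1 := by rw [hq]; exact pow_lt_one₀ hρ.le hρ1 (by norm_num)
  obtain ⟨c, D, hc, hD, h⟩ := exists_abs_ucoef_sub_le hρ hρ1 hq hK hβ
  have hs := summable_pow_mul_pow hq0 hq1 (D * ‖y‖)
  have hS : 0 ≤ ∑' i : ℕ, q ^ (i * (i + 1)) * (D * ‖y‖) ^ i :=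
    tsum_nonneg fun i => by positivity
  refine ⟨c * (∑' i : ℕ, q ^ (i * (i + 1)) * (D * ‖y‖) ^ i) + 1, by positivity, fun n => ?_⟩
  have hu : HasSum (fun i => (-1) ^ i * Complex.ofRealHom (ucoef q β n i) * y ^ i)
      (usum q β Complex.ofRealHom n y) := by
    refine hasSum_sum_of_ne_finset_zero fun i hi => ?_
    rw [ucoef_eq_zero n i (by simp at hi; omega)]
    simp
  have hd := hu.sub (summable_farCoef hq0 hq1 y).hasSum
  have hb := (hs.mul_left c).mul_right (ρ ^ n)
  change ‖_ - ∑' i, farCoef q i * y ^ i‖ ≤ _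
  rw [← hd.tsum_eq]
  calc _ ≤ ∑' i : ℕ, c * (q ^ (i * (i + 1)) * (D * ‖y‖) ^ i) * ρ ^ n := by
        refine tsum_of_norm_bounded hb.hasSum fun i => ?_
        have e : (-1) ^ i * Complex.ofRealHom (ucoef q β n i) * y ^ i - farCoef q i * y ^ i =
            (-1) ^ i * ((ucoef q β n i - vcoef q i : ℝ) : ℂ) * y ^ i := by
          simp only [farCoef, Complex.ofRealHom_eq_coe]
          push_cast
          ring
        rw [e, norm_mul, norm_mul, norm_pow, norm_neg, norm_one, one_pow, one_mul, norm_pow,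
          Complex.norm_real, Real.norm_eq_abs]
        calc _ ≤ c * D ^ i * q ^ (i * (i + 1)) * ρ ^ n * ‖y‖ ^ i := by
              gcongr
              exact h n i
          _ = _ := by ring
    _ = c * (∑' i : ℕ, q ^ (i * (i + 1)) * (D * ‖y‖) ^ i) * ρ ^ n := by
        rw [tsum_mul_right, tsum_mul_left]
    _ ≤ _ := by
        gcongr
        linarith

end FarField

section FarFieldTheorem

variable {q ρ : ℝ}

lemma farField (hρ : 0 < ρ) (hρ1 : ρ < 1) (hq : q = ρ ^ 4) (hq0 : 0 < q) (hq1 : q < 1)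
    (F : MonicOrthFamily q 1) (t : ℂ) (ht : t ≠ 0) : ∃ M : ℝ, 0 < M ∧ ∀ n, Even n →
      ‖(q : ℂ) ^ (n * (n / 2)) * t⁻¹ ^ n *
        aeval (t * (q : ℂ) ^ (-((n / 2 : ℕ) : ℤ))) (F.P n) - farSum q (t⁻¹ ^ 2)‖ ≤ M * ρ ^ n := by
  obtain ⟨K, hK, hα⟩ := exists_alpha_bound hρ hρ1 hq hq0 hq1 F
  set S := F.toQFreudSystem hq0 hq1
  obtain ⟨M, hM, h⟩ := exists_norm_usum_sub_le (β := fun n => q ^ (n - 1) * S.α n) hρ hρ1 hq hK.le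
    hα (t⁻¹ ^ 2)
  refine ⟨M, hM, fun n hn => ?_⟩
  obtain ⟨m, rfl⟩ := hn.two_dvd
  have hqC : (q : ℂ) ≠ 0 := by exact_mod_cast hq0.ne'
  rw [Nat.mul_div_cancel_left m two_pos]
  set s : ℂ := t * (q : ℂ) ^ (-(m : ℤ)) with hs
  have hs' : s = t * ((q : ℂ) ^ m)⁻¹ := by rw [hs, zpow_neg, zpow_natCast]
  have hs0 : s ≠ 0 := by rw [hs']; positivity
  have key := recurrence_eq_usum (β := fun n => q ^ (n - 1) * S.α n) Complex.ofRealHom hq0.ne' hs0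
    (f := fun n => aeval s (S.P n)) (by simp [S.P_zero]) (by simp [S.P_one]) (fun k => by
      have e : q⁻¹ ^ k * (q ^ (k + 1 - 1) * S.α (k + 1)) = S.α (k + 1) := by
        rw [Nat.add_sub_cancel, inv_pow, inv_mul_cancel_left₀ (pow_pos hq0 k).ne']
      simp only [S.P_add_two, map_sub, map_mul, aeval_X, aeval_C, e]
      rfl) (2 * m)
  have hy : (Complex.ofRealHom q)⁻¹ ^ (2 * m) * s⁻¹ ^ 2 = t⁻¹ ^ 2 := by
    rw [hs', Complex.ofRealHom_eq_coe]
    field_simp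
    rw [one_div, inv_pow, pow_mul', inv_mul_cancel₀ (by positivity)]
  have hp : (q : ℂ) ^ (2 * m * m) * t⁻¹ ^ (2 * m) * s ^ (2 * m) = 1 := by
    rw [hs', mul_pow, inv_pow, inv_pow, ← pow_mul, mul_comm m]
    field_simp
  rw [hy] at key
  change aeval s (F.P (2 * m)) = _ at key
  rw [key, ← mul_assoc, hp, one_mul]
  exact h _

end FarFieldTheorem

section PerturbedRecurrence

variable {q σ L : ℝ}

lemma exists_le_of_mul_one_add_le (hσ : 0 < σ) (hσ1 : σ < 1) (hL : 0 ≤ L) (Y₀ : ℝ) :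
    ∃ Y : ℝ, 0 < Y ∧ ∀ y : ℕ → ℝ, y 0 ≤ Y₀ → (∀ m, y (m + 1) ≤ y m * (1 + L * σ ^ m)) →
      ∀ m, y m ≤ Y := by
  refine ⟨max Y₀ 1 * Real.exp (L * (1 - σ)⁻¹), by positivity, fun y hy0 hy m => ?_⟩
  have h : y m ≤ max Y₀ 1 * Real.exp (L * ∑ i ∈ Finset.range m, σ ^ i) := by
    induction m with
    | zero => simpa using Or.inl hy0
    | succ m ih =>
      have h1 : 1 + L * σ ^ m ≤ Real.exp (L * σ ^ m) := by
        rw [add_comm]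
        exact Real.add_one_le_exp _
      calc y (m + 1) ≤ y m * (1 + L * σ ^ m) := hy m
        _ ≤ max Y₀ 1 * Real.exp (L * ∑ i ∈ Finset.range m, σ ^ i) * Real.exp (L * σ ^ m) := by
          gcongr
        _ = _ := by rw [Finset.sum_range_succ, mul_add, Real.exp_add, mul_assoc]
  refine h.trans ?_
  gcongr
  rw [← tsum_geometric_of_lt_one hσ.le hσ1]
  exact (summable_geometric_of_lt_one hσ.le hσ1).sum_le_tsum _ fun k _ => by positivity

/-- Solutions of an exponentially small perturbation of `r(m+2) = (1 + q) r(m+1) - q r(m)` converge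
exponentially fast, uniformly in the perturbation. -/
lemma exists_norm_sub_le_of_recurrence (hq0 : 0 < q) (hqσ : q < σ) (hσ1 : σ < 1) (hL : 0 ≤ L) :
    ∃ M : ℝ, 0 < M ∧ ∀ r ε δ : ℕ → ℂ, ‖r 0‖ ≤ L → ‖r 1‖ ≤ L → (∀ m, ‖ε m‖ ≤ L * σ ^ m) →
      (∀ m, ‖δ m‖ ≤ L * σ ^ m) →
      (∀ m, r (m + 2) = (1 + q + ε m) * r (m + 1) - (q + δ m) * r m) →
      ∀ m, ‖r (m + 1) - r m‖ ≤ M * σ ^ m := by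
  have hσ : 0 < σ := hq0.trans hqσ
  have hq1 : 0 < 1 - q := by linarith
  set k := (1 - q)⁻¹ with hk
  have hk1 : 1 ≤ k := one_le_inv₀ hq1 |>.mpr (by linarith)
  have hkq : 1 + k * q = k := by
    rw [hk]
    field_simp
    ring
  obtain ⟨Y, hY, hbd⟩ := exists_le_of_mul_one_add_le hσ hσ1 (by positivity : 0 ≤ 5 * k * L)
    (L + k * (2 * L))
  have hgap : 0 < σ - q := by linarith
  refine ⟨max Y (3 * L * Y / (σ - q)), by positivity, fun r ε δ h0 h1 hε hδ hr => ?_⟩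
  set s : ℕ → ℝ := fun m => ‖r m‖ with hs
  set d : ℕ → ℝ := fun m => ‖r (m + 1) - r m‖ with hd
  have hs0 : ∀ m, 0 ≤ s m := fun m => norm_nonneg _
  have hd0 : ∀ m, 0 ≤ d m := fun m => norm_nonneg _
  have hsd : ∀ m, s (m + 1) ≤ s m + d m := by
    intro m
    have := norm_add_le (r m) (r (m + 1) - r m)
    rwa [add_sub_cancel] at this
  have hdd : ∀ m, d (m + 1) ≤ (q + L * σ ^ m) * d m + 2 * (L * σ ^ m) * s (m + 1) := by
    intro m
    have e : r (m + 2) - r (m + 1) = (q + δ m) * (r (m + 1) - r m) + (ε m - δ m) * r (m + 1) := by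
      rw [hr]
      ring
    calc d (m + 1) = ‖(q + δ m) * (r (m + 1) - r m) + (ε m - δ m) * r (m + 1)‖ := by rw [← e]
      _ ≤ (‖(q : ℂ)‖ + ‖δ m‖) * d m + (‖ε m‖ + ‖δ m‖) * s (m + 1) := by
        refine (norm_add_le _ _).trans ?_
        rw [norm_mul, norm_mul]
        gcongr
        · exact norm_add_le _ _
        · exact norm_sub_le _ _
      _ ≤ _ := by
        rw [Complex.norm_real, Real.norm_eq_abs, abs_of_pos hq0, two_mul]
        have := hs0 (m + 1)
        have := hd0 m
        gcongr
        exacts [hδ m, hε m, hδ m]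
  have hy : ∀ m, s m + k * d m ≤ Y := by
    refine hbd (fun m => s m + k * d m) ?_ fun m => ?_
    · have : d 0 ≤ L + L := (norm_sub_le _ _).trans (add_le_add h1 h0)
      have : k * d 0 ≤ k * (2 * L) := by
        gcongr
        linarith
      exact add_le_add h0 this
    · set w := L * σ ^ m with hw
      have hw0 : 0 ≤ w := by positivity
      have e1 : k * d (m + 1) ≤ k * ((q + w) * d m + 2 * w * (s m + d m)) := by
        gcongr
        refine (hdd m).trans ?_
        gcongr
        exact hsd m
      have e2 := mul_nonneg hw0 (hs0 m)
      have e3 := mul_nonneg hw0 (hd0 m)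
      have e4 : 0 ≤ k * (w * s m) := by positivity
      have e5 : 0 ≤ (k - 1) * (k * (w * d m)) :=
        mul_nonneg (by linarith) (by positivity)
      calc s (m + 1) + k * d (m + 1)
          ≤ s m + d m + k * ((q + w) * d m + 2 * w * (s m + d m)) := add_le_add (hsd m) e1
        _ = s m + (1 + k * q) * d m + 3 * (k * (w * d m)) + 2 * (k * (w * s m)) := by ring
        _ ≤ (s m + k * d m) * (1 + 5 * k * w) := by
          rw [hkq]
          linarith [e4, e5, show 0 ≤ k * (w * d m) by positivity]
        _ = _ := by rw [hw]; ring
  intro m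
  induction m with
  | zero =>
    have := hy 0
    have := hs0 0
    have : d 0 ≤ k * d 0 := le_mul_of_one_le_left (hd0 0) hk1
    rw [pow_zero, mul_one]
    exact le_trans (by linarith : d 0 ≤ Y) (le_max_left _ _)
  | succ m ih =>
    set M := max Y (3 * L * Y / (σ - q))
    have hM : 3 * L * Y ≤ M * (σ - q) := by
      rw [← div_le_iff₀ hgap]
      exact le_max_right _ _
    have hdY : d m ≤ Y := by
      have := hy m
      have := hs0 m
      have : d m ≤ k * d m := le_mul_of_one_le_left (hd0 m) hk1
      linarith
    have hsY : s (m + 1) ≤ Y := by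
      have := hy (m + 1)
      have : 0 ≤ k * d (m + 1) := by have := hd0 (m + 1); positivity
      linarith
    have hσm : 0 < σ ^ m := by positivity
    calc d (m + 1) ≤ (q + L * σ ^ m) * d m + 2 * (L * σ ^ m) * s (m + 1) := hdd m
      _ = q * d m + L * σ ^ m * d m + 2 * (L * σ ^ m) * s (m + 1) := by ring
      _ ≤ q * (M * σ ^ m) + L * σ ^ m * Y + 2 * (L * σ ^ m) * Y := by gcongr
      _ = q * (M * σ ^ m) + 3 * L * Y * σ ^ m := by ring
      _ ≤ q * (M * σ ^ m) + M * (σ - q) * σ ^ m := by gcongr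
      _ = _ := by ring

lemma exists_tendsto_of_norm_sub_le {M : ℝ} (hσ1 : σ < 1) {r : ℕ → ℂ}
    (h : ∀ m, ‖r (m + 1) - r m‖ ≤ M * σ ^ m) :
    ∃ l, Filter.Tendsto r Filter.atTop (𝓝 l) ∧ ∀ m, ‖r m - l‖ ≤ M / (1 - σ) * σ ^ m := by
  have h' : ∀ m, dist (r m) (r (m + 1)) ≤ M * σ ^ m := by
    intro m
    rw [dist_comm, dist_eq_norm]
    exact h m
  obtain ⟨l, hl⟩ := cauchySeq_tendsto_of_complete (cauchySeq_of_le_geometric _ _ hσ1 h')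
  refine ⟨l, hl, fun m => ?_⟩
  rw [← dist_eq_norm, div_mul_eq_mul_div]
  exact dist_le_of_le_geometric_of_tendsto _ _ hσ1 h' hl m

lemma tendsto_prod_ne_zero (hσ : 0 < σ) (hσ1 : σ < 1) {a : ℕ → ℝ} (ha : ∀ m, 0 < a m)
    (hb : ∀ m, |a m - 1| ≤ L * σ ^ m) : ∃ l : ℝ, l ≠ 0 ∧
      Filter.Tendsto (fun m => ∏ i ∈ Finset.range m, a i) Filter.atTop (𝓝 l) := by
  have hs : Summable fun m => ‖a m - 1‖ :=
    Summable.of_nonneg_of_le (fun m => norm_nonneg _) hb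
      ((summable_geometric_of_lt_one hσ.le hσ1).mul_left L)
  have h1 : ∀ m, 1 + (a m - 1) = a m := fun m => by ring
  refine ⟨∏' m, (1 + (a m - 1)),
    tprod_one_add_ne_zero_of_summable (fun m => by rw [h1]; exact (ha m).ne') hs, ?_⟩
  simpa only [h1] using (multipliable_one_add_of_summable hs).tendsto_prod_tprod_nat

end PerturbedRecurrence

section NearField

variable {q : ℝ}

namespace QFreudSystem

variable (S : QFreudSystem q)

/-- The normalized even-degree polynomials. -/
noncomputable def near (m : ℕ) (z : ℂ) : ℂ :=
  (-1) ^ m * (q : ℂ) ^ (m * (m - 1)) * aeval z (S.P (2 * m))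

lemma near_zero (z : ℂ) : S.near 0 z = 1 := by simp [near, S.P_zero]

lemma near_one (z : ℂ) : S.near 1 z = S.α 1 - z ^ 2 := by
  rw [near, mul_one, S.P_add_two 0, zero_add, S.P_one, S.P_zero]
  simp
  ring

lemma near_add_two (m : ℕ) (z : ℂ) : S.near (m + 2) z =
    (q ^ (2 * (m + 1)) * S.α (2 * (m + 1)) + q ^ (2 * (m + 1)) * S.α (2 * (m + 1) + 1) -
      q ^ (2 * (m + 1)) * z ^ 2) * S.near (m + 1) z -
    q ^ (2 * (m + 1)) * S.α (2 * (m + 1)) * (q ^ (2 * m) * S.α (2 * m + 1)) * S.near m z := by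
  have h1 := congrArg (aeval z) (S.P_add_two (2 * m))
  have h2 := congrArg (aeval z) (S.P_add_two (2 * m + 1))
  have h3 := congrArg (aeval z) (S.P_add_two (2 * m + 2))
  simp only [map_sub, map_mul, aeval_X, aeval_C, Complex.coe_algebraMap] at h1 h2 h3
  have e1 : (m + 2) * (m + 2 - 1) = m * (m - 1) + (4 * m + 2) := by
    rcases m with _ | m
    · rfl
    · simp only [Nat.add_sub_cancel, show m + 1 + 2 - 1 = m + 2 by omega]
      ring
  have e2 : (m + 1) * (m + 1 - 1) = m * (m - 1) + 2 * m := by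
    rcases m with _ | m
    · rfl
    · simp only [Nat.add_sub_cancel]
      ring
  simp only [near, e1, e2, show 2 * (m + 2) = 2 * m + 2 + 2 by ring,
    show 2 * (m + 1) = 2 * m + 2 by ring, show 2 * m + 2 + 1 = 2 * m + 1 + 2 by ring]
    at h1 h2 h3 ⊢
  simp only [show 2 * m + 1 + 1 = 2 * m + 2 by ring] at h1 h2 h3 ⊢
  rw [h3, h2]
  linear_combination (-1) ^ m * (q : ℂ) ^ (m * (m - 1) + (4 * m + 2)) *
    S.α (2 * m + 2) * h1

lemma near_apply_zero (m : ℕ) :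
    S.near m 0 = ((∏ i ∈ Finset.range m, q ^ (2 * i) * S.α (2 * i + 1) : ℝ) : ℂ) := by
  induction m with
  | zero => simp [near_zero]
  | succ m ih =>
    rw [Finset.prod_range_succ, Complex.ofReal_mul, ← ih]
    have h := S.coeff_zero_add_two (2 * m)
    have e2 : (m + 1) * (m + 1 - 1) = m * (m - 1) + 2 * m := by
      rcases m with _ | m
      · rfl
      · simp only [Nat.add_sub_cancel]
        ring
    have hz : ∀ p : ℝ[X], aeval (0 : ℂ) p = ((p.coeff 0 : ℝ) : ℂ) := fun p => by
      rw [← coeff_zero_eq_aeval_zero']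
      rfl
    simp only [near, e2, hz, show 2 * (m + 1) = 2 * m + 2 by ring, h]
    push_cast
    ring

lemma near_neg (m : ℕ) (z : ℂ) : S.near m (-z) = S.near m z := by
  have h := congrArg (aeval z) (S.P_comp_neg (2 * m))
  simp only [aeval_comp, map_neg, aeval_X] at h
  rw [near, near, h]
  simp

lemma differentiable_near (m : ℕ) : Differentiable ℂ (S.near m) :=
  (S.P (2 * m)).differentiable_aeval.const_mul _

variable {σ K : ℝ}

lemma exists_near_bound (hq0 : 0 < q) (hqσ : q = σ ^ 2) (hσ : 0 < σ) (hσ1 : σ < 1) (hK : 0 ≤ K)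
    (ha : ∀ m, |q ^ (2 * m) * S.α (2 * m + 1) - 1| ≤ K * σ ^ m)
    (hb : ∀ m, |q ^ (2 * (m + 1)) * S.α (2 * (m + 1)) - q| ≤ K * σ ^ m) (r : ℝ) :
    ∃ M : ℝ, 0 < M ∧ ∀ z : ℂ, ‖z‖ ≤ r →
      ∀ m, ‖S.near (m + 1) z - S.near m z‖ ≤ M * σ ^ m := by
  have hqσ' : q < σ := by nlinarith
  set L := (K + 2) ^ 2 + r ^ 2 with hL
  have hL0 : 0 ≤ L := by positivity
  obtain ⟨M, hM, h⟩ := exists_norm_sub_le_of_recurrence hq0 hqσ' hσ1 hL0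
  refine ⟨M, hM, fun z hz => ?_⟩
  set a : ℕ → ℝ := fun m => q ^ (2 * m) * S.α (2 * m + 1) with hadef
  set b : ℕ → ℝ := fun m => q ^ (2 * (m + 1)) * S.α (2 * (m + 1)) with hbdef
  have hr0 : 0 ≤ r := (norm_nonneg z).trans hz
  have hz2 : ‖z ^ 2‖ ≤ r ^ 2 := by
    rw [norm_pow]
    gcongr
  have hσm : ∀ m, σ ^ m ≤ 1 := fun m => pow_le_one₀ hσ.le hσ1.le
  have hbK : ∀ m, |b m| ≤ K + 1 := fun m => by
    have h1 := abs_add_le (b m - q) q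
    rw [sub_add_cancel, abs_of_pos hq0] at h1
    have h2 : K * σ ^ m ≤ K * 1 := by
      gcongr
      exact hσm m
    linarith [hb m]
  refine h (fun m => S.near m z)
    (fun m => ((b m - q : ℝ) : ℂ) + ((a (m + 1) - 1 : ℝ) : ℂ) - (q : ℂ) ^ (2 * (m + 1)) * z ^ 2)
    (fun m => ((b m * (a m - 1) + (b m - q) : ℝ) : ℂ)) ?_ ?_ (fun m => ?_) (fun m => ?_)
    (fun m => ?_)
  · simp only [near_zero, norm_one]
    nlinarith
  · simp only [near_one]
    refine (norm_sub_le _ _).trans ?_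
    rw [Complex.norm_real, Real.norm_eq_abs]
    have h1 := ha 0
    simp only [mul_zero, pow_zero, one_mul, mul_one, zero_add] at h1
    have h2 := abs_add_le (S.α 1 - 1) 1
    rw [sub_add_cancel, abs_one] at h2
    nlinarith
  · refine (norm_sub_le _ _).trans ((add_le_add_left (norm_add_le _ _) _).trans ?_)
    rw [Complex.norm_real, Complex.norm_real, Real.norm_eq_abs, Real.norm_eq_abs, norm_mul,
      norm_pow, Complex.norm_real, Real.norm_eq_abs, abs_of_pos hq0]
    have h1 : K * σ ^ (m + 1) ≤ K * σ ^ m := by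
      gcongr K * ?_
      exact pow_le_pow_of_le_one hσ.le hσ1.le (Nat.le_succ m)
    have h2 : q ^ (2 * (m + 1)) ≤ σ ^ m := by
      rw [hqσ, ← pow_mul]
      exact pow_le_pow_of_le_one hσ.le hσ1.le (by omega)
    have h3 : q ^ (2 * (m + 1)) * ‖z ^ 2‖ ≤ σ ^ m * r ^ 2 := by gcongr
    have h4 : (2 * K + r ^ 2) * σ ^ m ≤ L * σ ^ m := by
      gcongr
      nlinarith
    have := hb m
    have := ha (m + 1)
    linarith
  · rw [Complex.norm_real, Real.norm_eq_abs]
    calc _ ≤ |b m| * |a m - 1| + |b m - q| := by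
          rw [← abs_mul]
          exact abs_add_le _ _
      _ ≤ (K + 1) * (K * σ ^ m) + K * σ ^ m := by
          gcongr
          exacts [hbK m, ha m, hb m]
      _ = (K ^ 2 + 2 * K) * σ ^ m := by ring
      _ ≤ L * σ ^ m := by
          gcongr
          nlinarith [sq_nonneg r]
  · simp only [near_add_two, hadef, hbdef]
    push_cast
    ring

/-- Locally uniform convergence of the normalized even-degree polynomials. -/
lemma exists_near_limit (hq0 : 0 < q) (hqσ : q = σ ^ 2) (hσ : 0 < σ) (hσ1 : σ < 1) (hK : 0 ≤ K)
    (ha : ∀ m, |q ^ (2 * m) * S.α (2 * m + 1) - 1| ≤ K * σ ^ m)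
    (hb : ∀ m, |q ^ (2 * (m + 1)) * S.α (2 * (m + 1)) - q| ≤ K * σ ^ m) :
    ∃ (R : ℂ → ℂ) (c : ℝ), Differentiable ℂ R ∧ (∀ z, R (-z) = R z) ∧ c ≠ 0 ∧ R 0 = c ∧
      (∀ z, Filter.Tendsto (fun m => S.near m z) Filter.atTop (𝓝 (R z))) ∧
      ∀ T : Set ℂ, IsCompact T → ∃ M : ℝ, 0 < M ∧
        ∀ m, ∀ z ∈ T, ‖S.near m z - R z‖ ≤ M * σ ^ m := by
  choose B hB hB' using S.exists_near_bound hq0 hqσ hσ hσ1 hK ha hb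
  have hR := fun z => exists_tendsto_of_norm_sub_le (r := fun m => S.near m z) hσ1 (hB' ‖z‖ z le_rfl)
  choose R hR1 hR2 using hR
  have h1σ : 0 < 1 - σ := by linarith
  have hcomp : ∀ T : Set ℂ, IsCompact T → ∃ M : ℝ, 0 < M ∧
      ∀ m, ∀ z ∈ T, ‖S.near m z - R z‖ ≤ M * σ ^ m := by
    intro T hT
    obtain ⟨r, hr⟩ := hT.isBounded.exists_norm_le
    refine ⟨B r / (1 - σ), div_pos (hB r) h1σ, fun m z hz => ?_⟩
    obtain ⟨l, hl, hl2⟩ := exists_tendsto_of_norm_sub_le (r := fun m => S.near m z) hσ1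
      (hB' r z (hr z hz))
    rw [tendsto_nhds_unique (hR1 z) hl]
    exact hl2 m
  have hunif : TendstoLocallyUniformlyOn S.near R Filter.atTop Set.univ := by
    rw [tendstoLocallyUniformlyOn_iff_forall_isCompact isOpen_univ]
    intro T _ hT
    obtain ⟨M, hM, h⟩ := hcomp T hT
    rw [Metric.tendstoUniformlyOn_iff]
    intro ε hε
    have h0 : Filter.Tendsto (fun m => M * σ ^ m) Filter.atTop (𝓝 0) := by
      simpa using (tendsto_pow_atTop_nhds_zero_of_lt_one hσ.le hσ1).const_mul M
    filter_upwards [h0.eventually (gt_mem_nhds hε)] with m hm z hz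
    rw [dist_comm, dist_eq_norm]
    exact (h m z hz).trans_lt hm
  obtain ⟨c, hc, hlim⟩ := tendsto_prod_ne_zero hσ hσ1
    (fun m => mul_pos (pow_pos hq0 _) (S.α_pos _)) ha
  refine ⟨R, c, ?_, fun z => ?_, hc, ?_, hR1, hcomp⟩
  · rw [← differentiableOn_univ]
    exact hunif.differentiableOn
      (Filter.Eventually.of_forall fun m => (S.differentiable_near m).differentiableOn) isOpen_univ
  · refine tendsto_nhds_unique (hR1 (-z)) ?_
    simpa only [near_neg] using hR1 z
  · refine tendsto_nhds_unique (hR1 0) ?_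
    simp only [near_apply_zero]
    exact (Complex.continuous_ofReal.tendsto c).comp hlim

end QFreudSystem

end NearField

section NearFieldEquation

open Filter

variable {q : ℝ}

lemma tendsto_zero_of_recurrence {l : ℝ} (hl0 : 0 ≤ l) (hl1 : l < 1) {e f u : ℕ → ℝ}
    (he : ∀ m, e (m + 1) = u m + f m * e m) (hf : Tendsto f atTop (𝓝 l))
    (hu : ∀ m, |u m| ≤ l ^ m) : Tendsto e atTop (𝓝 0) := by
  set c := (1 + l) / 2 with hc
  set c' := (1 + c) / 2 with hc'
  have hlc : l < c := by linarith
  have hcc' : c < c' := by linarith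
  have hc'1 : c' < 1 := by linarith
  have hlc' : |l| < c := by rwa [abs_of_nonneg hl0]
  obtain ⟨N, hN⟩ := eventually_atTop.mp (hf.abs.eventually (gt_mem_nhds hlc'))
  obtain ⟨B, hB, hB'⟩ : ∃ B : ℝ, |e N| ≤ B ∧ 1 ≤ B * (c' - c) := by
    refine ⟨max |e N| (1 / (c' - c)), le_max_left _ _, ?_⟩
    rw [← div_le_iff₀ (by linarith)]
    exact le_max_right _ _
  have hc0 : 0 ≤ c' := by linarith
  have hbd : ∀ j, |e (j + N)| ≤ B * c' ^ j := by
    intro j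
    induction j with
    | zero => simpa using hB
    | succ j ih =>
      rw [show j + 1 + N = j + N + 1 by ring, he]
      have h1 : |u (j + N)| ≤ c' ^ j := (hu _).trans <|
        (pow_le_pow_of_le_one hl0 hl1.le (Nat.le_add_right j N)).trans
          (pow_le_pow_left₀ hl0 (by linarith) j)
      have h2 : |f (j + N)| ≤ c := (hN _ (Nat.le_add_left _ _)).le
      calc _ ≤ |u (j + N)| + |f (j + N)| * |e (j + N)| := by
            rw [← abs_mul]
            exact abs_add_le _ _
        _ ≤ 1 * c' ^ j + c * (B * c' ^ j) := by
            rw [one_mul]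
            gcongr
        _ ≤ B * (c' - c) * c' ^ j + c * (B * c' ^ j) := by gcongr
        _ = _ := by ring
  rw [← tendsto_add_atTop_iff_nat N]
  refine squeeze_zero_norm hbd ?_
  simpa using (tendsto_pow_atTop_nhds_zero_of_lt_one hc0 hc'1).const_mul B

lemma tendsto_two_mul_add_atTop (k : ℕ) : Tendsto (fun m : ℕ => 2 * m + k) atTop atTop :=
  tendsto_atTop_mono (fun m => by omega : ∀ m : ℕ, m ≤ 2 * m + k) tendsto_id

namespace QFreudSystem

variable (S : QFreudSystem q)

/-- Ratio of the linear coefficient of `P₂ₘ₊₅` to the constant coefficient of `P₂ₘ₊₄`. -/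
noncomputable def coeffRatio (m : ℕ) : ℝ :=
  (S.P (2 * m + 5)).coeff 1 / (S.P (2 * m + 4)).coeff 0

lemma coeffRatio_succ (m : ℕ) : S.coeffRatio (m + 1) =
    1 + S.α (2 * m + 6) / S.α (2 * m + 5) * S.coeffRatio m := by
  have h1 := congrArg (fun p => p.coeff 1) (S.P_add_two (2 * m + 5))
  have h2 := S.coeff_zero_add_two (2 * m + 4)
  have h3 : (S.P (2 * m + 4)).coeff 0 ≠ 0 := S.coeff_zero_ne_zero (m + 2)
  have h4 := (S.α_pos (2 * m + 5)).ne'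
  simp only [coeff_sub, coeff_C_mul, coeff_X_mul] at h1
  simp only [coeffRatio, show 2 * (m + 1) + 5 = 2 * m + 5 + 2 by ring,
    show 2 * (m + 1) + 4 = 2 * m + 4 + 2 by ring, h1, h2]
  simp only [show 2 * m + 5 + 1 = 2 * m + 4 + 2 by ring, h2] at *
  field_simp
  ring

lemma offDiag_ne_zero (hq0 : 0 < q) (m : ℕ) : S.offDiag (2 * m) ≠ 0 := by
  intro h
  have := S.offDiag_mul hq0.ne' (2 * m) (even_two_mul m)
  have h1 := S.α_pos (2 * m + 4)
  have h2 := S.α_pos (2 * m + 5)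
  rw [h, zero_mul] at this
  have : 0 < q ^ (2 * m + 3) * S.α (2 * m + 4) + q ^ (2 * m + 4) * S.α (2 * m + 5) := by
    positivity
  linarith

lemma tendsto_offDiag (hq0 : 0 < q) (hq1 : q < 1)
    (hα : Tendsto (fun n => q ^ n * S.α (n + 1)) atTop (𝓝 1)) :
    Tendsto (fun m => S.offDiag (2 * m)) atTop (𝓝 0) := by
  have hA : Tendsto (fun m => q ^ (2 * m + 4) * S.α (2 * m + 5)) atTop (𝓝 1) :=
    hα.comp (tendsto_two_mul_add_atTop 4)
  have hB : Tendsto (fun m => q ^ (2 * m + 5) * S.α (2 * m + 6)) atTop (𝓝 1) :=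
    hα.comp (tendsto_two_mul_add_atTop 5)
  have hp : Tendsto (fun m => q ^ (2 * m + 4)) atTop (𝓝 0) :=
    (tendsto_pow_atTop_nhds_zero_of_lt_one hq0.le hq1).comp (tendsto_two_mul_add_atTop 4)
  have key : Tendsto (fun m => (q⁻¹ - q ^ (2 * m + 4) -
      q⁻¹ * (q ^ (2 * m + 5) * S.α (2 * m + 6)) * (q ^ (2 * m + 4) * S.α (2 * m + 5))) /
      (q ^ (2 * m + 4) * S.α (2 * m + 5))) atTop (𝓝 ((q⁻¹ - 0 - q⁻¹ * 1 * 1) / 1)) :=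
    ((tendsto_const_nhds.sub hp).sub ((hB.const_mul _).mul hA)).div hA one_ne_zero
  rw [show (q⁻¹ - 0 - q⁻¹ * 1 * 1) / 1 = 0 by ring] at key
  refine key.congr fun m => ?_
  have h := S.offDiag_eq hq0.ne' (2 * m) (even_two_mul m)
  have h4 := (S.α_pos (2 * m + 5)).ne'
  rw [div_eq_iff (mul_ne_zero (by positivity) h4)]
  have e : q ^ (2 * m + 4) * q⁻¹ ^ (2 * m + 5) = q⁻¹ := by
    rw [pow_succ q⁻¹, ← mul_assoc, ← mul_pow, mul_inv_cancel₀ hq0.ne', one_pow, one_mul]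
  have e' : q⁻¹ * q ^ (2 * m + 5) = q ^ (2 * m + 4) := by
    rw [pow_succ]
    field_simp
  linear_combination (-q ^ (2 * m + 4)) * h - e -
    q ^ (2 * m + 4) * S.α (2 * m + 5) * S.α (2 * m + 6) * e'

lemma tendsto_pow_mul_coeffRatio (hq0 : 0 < q) (hq1 : q < 1)
    (hα : Tendsto (fun n => q ^ n * S.α (n + 1)) atTop (𝓝 1)) :
    Tendsto (fun m => q ^ (2 * m + 4) * S.coeffRatio m) atTop (𝓝 0) := by
  have hA : Tendsto (fun m => q ^ (2 * m + 4) * S.α (2 * m + 5)) atTop (𝓝 1) :=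
    hα.comp (tendsto_two_mul_add_atTop 4)
  have hB : Tendsto (fun m => q ^ (2 * m + 5) * S.α (2 * m + 6)) atTop (𝓝 1) :=
    hα.comp (tendsto_two_mul_add_atTop 5)
  have hf := (hB.div hA one_ne_zero).const_mul q
  rw [div_one, mul_one] at hf
  refine tendsto_zero_of_recurrence hq0.le hq1 (u := fun m => q ^ (2 * m + 6)) (fun m => ?_) hf
    fun m => ?_
  · have h4 := (S.α_pos (2 * m + 5)).ne'
    rw [coeffRatio_succ]
    simp only [Pi.div_apply]
    field_simp
    ring
  · rw [abs_of_pos (by positivity)]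
    exact pow_le_pow_of_le_one hq0.le hq1.le (by omega)

lemma tendsto_pow_div_offDiag (hq0 : 0 < q) (hq1 : q < 1)
    (hα : Tendsto (fun n => q ^ n * S.α (n + 1)) atTop (𝓝 1)) :
    Tendsto (fun m => q ^ (2 * m + 4) / S.offDiag (2 * m)) atTop (𝓝 0) := by
  have hA : Tendsto (fun m => q ^ (2 * m + 4) * S.α (2 * m + 5)) atTop (𝓝 1) :=
    hα.comp (tendsto_two_mul_add_atTop 4)
  have hB : Tendsto (fun m => q ^ (2 * m + 3) * S.α (2 * m + 4)) atTop (𝓝 1) :=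
    hα.comp (tendsto_two_mul_add_atTop 3)
  have hp : Tendsto (fun m => q ^ (2 * m + 4)) atTop (𝓝 0) :=
    (tendsto_pow_atTop_nhds_zero_of_lt_one hq0.le hq1).comp (tendsto_two_mul_add_atTop 4)
  have key := ((hp.mul_const q).add
    ((S.tendsto_pow_mul_coeffRatio hq0 hq1 hα).const_mul (1 - q))).div (hB.add hA) (by norm_num)
  simp only [zero_mul, mul_zero, add_zero, zero_div] at key
  refine key.congr fun m => ?_
  have := S.offDiag_mul hq0.ne' (2 * m) (even_two_mul m)
  have h1 := S.α_pos (2 * m + 4)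
  have h2 := S.α_pos (2 * m + 5)
  have hpos : 0 < q ^ (2 * m + 3) * S.α (2 * m + 4) + q ^ (2 * m + 4) * S.α (2 * m + 5) := by
    positivity
  simp only [Pi.div_apply]
  rw [div_eq_div_iff hpos.ne' (S.offDiag_ne_zero hq0 m), ← this, coeffRatio]
  ring

/-- Elimination of the odd-degree polynomial from the two dilation formulas. -/
lemma near_functional_eq (hq0 : q ≠ 0) (m : ℕ) (hb : S.offDiag (2 * m) ≠ 0) (x : ℂ) :
    ((q : ℂ)⁻¹ + (q : ℂ)⁻¹ ^ 3 * ((q ^ (2 * m + 4) / S.offDiag (2 * m) : ℝ) : ℂ) * x ^ 2) * (1 + x ^ 4) *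
        S.near (m + 2) (q * x) +
      (1 + ((q ^ (2 * m + 4) / S.offDiag (2 * m) : ℝ) : ℂ) * x ^ 2) * S.near (m + 2) ((q : ℂ)⁻¹ * x) =
    (((q : ℂ)⁻¹ + (q : ℂ)⁻¹ ^ 3 * ((q ^ (2 * m + 4) / S.offDiag (2 * m) : ℝ) : ℂ) * x ^ 2) *
        (1 - ((q ^ (2 * m + 4) * S.α (2 * m + 5) : ℝ) : ℂ) * x ^ 2) +
      (1 + ((q ^ (2 * m + 4) / S.offDiag (2 * m) : ℝ) : ℂ) * x ^ 2) *
        (1 + (q : ℂ)⁻¹ ^ 3 * ((q ^ (2 * m + 4) : ℝ) : ℂ) * x ^ 4 + (S.offDiag (2 * m) * (q : ℂ)⁻¹ -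
          (q : ℂ)⁻¹ ^ 2 * ((q ^ (2 * m + 3) * S.α (2 * m + 4) : ℝ) : ℂ)) * x ^ 2)) *
      S.near (m + 2) x := by
  have h1 := congrArg (aeval x) (S.dilate_eq hq0 (2 * m) (even_two_mul m))
  have h2 := congrArg (aeval x) (S.contract_eq hq0 (2 * m) (even_two_mul m))
  simp only [aeval_comp, map_sub, map_add, map_mul, map_pow, aeval_X, aeval_C, map_one,
    Complex.coe_algebraMap] at h1 h2
  have hqC : (q : ℂ) ≠ 0 := by exact_mod_cast hq0
  have hbC : (S.offDiag (2 * m) : ℂ) ≠ 0 := by exact_mod_cast hb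
  simp only [near, show 2 * (m + 2) = 2 * m + 4 by ring]
  set b := (S.offDiag (2 * m) : ℂ)
  set κ : ℂ := (-1) ^ (m + 2) * (q : ℂ) ^ ((m + 2) * (m + 2 - 1))
  set θ : ℂ := ((q ^ (2 * m + 4) / S.offDiag (2 * m) : ℝ) : ℂ) with hθ
  have hθ' : (q : ℂ) ^ (2 * m + 4) = θ * b := by
    rw [hθ]
    push_cast
    exact (div_mul_cancel₀ _ hbC).symm
  have e1 : (q : ℂ) ^ (2 * m + 1) = (q : ℂ)⁻¹ ^ 3 * (θ * b) := by
    rw [← hθ', pow_add, pow_add]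
    field_simp
  have e3 : (q : ℂ) ^ (2 * m + 3) = (q : ℂ)⁻¹ * (θ * b) := by
    rw [← hθ', pow_add, pow_add]
    field_simp
  push_cast at h1 h2 ⊢
  simp only [hθ', e1, e3] at h1 h2 ⊢
  linear_combination κ * ((q : ℂ)⁻¹ + (q : ℂ)⁻¹ ^ 3 * θ * x ^ 2) * h1 + κ * (1 + θ * x ^ 2) * h2

end QFreudSystem

end NearFieldEquation

section NearFieldTheorem

open Filter

variable {q : ℝ}

lemma QFreudSystem.near_limit_functional_eq (S : QFreudSystem q) (hq0 : 0 < q) (hq1 : q < 1)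
    (hα : Tendsto (fun n => q ^ n * S.α (n + 1)) atTop (𝓝 1)) {R : ℂ → ℂ}
    (hR : ∀ z, Tendsto (fun m => S.near m z) atTop (𝓝 (R z))) (x : ℂ) :
    (q : ℂ)⁻¹ * (1 + x ^ 4) * R (q * x) + R ((q : ℂ)⁻¹ * x) =
      ((q : ℂ)⁻¹ * (1 - x ^ 2) + (1 - (q : ℂ)⁻¹ ^ 2 * x ^ 2)) * R x := by
  have hcast : ∀ {f : ℕ → ℝ} {l : ℝ}, Tendsto f atTop (𝓝 l) →
      Tendsto (fun m => (f m : ℂ)) atTop (𝓝 (l : ℂ)) :=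
    fun h => (Complex.continuous_ofReal.tendsto _).comp h
  have hR' : ∀ z, Tendsto (fun m => S.near (m + 2) z) atTop (𝓝 (R z)) :=
    fun z => (hR z).comp (tendsto_add_atTop_nat 2)
  have hA := hcast (hα.comp (tendsto_two_mul_add_atTop 4))
  have hB := hcast (hα.comp (tendsto_two_mul_add_atTop 3))
  have hp := hcast ((tendsto_pow_atTop_nhds_zero_of_lt_one hq0.le hq1).comp
    (tendsto_two_mul_add_atTop 4))
  have hb := hcast (S.tendsto_offDiag hq0 hq1 hα)
  have hθ := hcast (S.tendsto_pow_div_offDiag hq0 hq1 hα)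
  have hl := (hθ.const_mul ((q : ℂ)⁻¹ ^ 3)).mul_const (x ^ 2) |>.const_add (q : ℂ)⁻¹
  have hr := (hθ.mul_const (x ^ 2)).const_add 1
  have h1 := ((hl.mul_const (1 + x ^ 4)).mul (hR' (q * x))).add (hr.mul (hR' ((q : ℂ)⁻¹ * x)))
  have h2 := ((hl.mul ((hA.mul_const (x ^ 2)).const_sub 1)).add
    (hr.mul ((((hp.const_mul ((q : ℂ)⁻¹ ^ 3)).mul_const (x ^ 4)).const_add 1).add
      (((hb.mul_const (q : ℂ)⁻¹).sub (hB.const_mul ((q : ℂ)⁻¹ ^ 2))).mul_const (x ^ 2))))).mul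
    (hR' x)
  have h := tendsto_nhds_unique (h1.congr fun m =>
    S.near_functional_eq hq0.ne' m (S.offDiag_ne_zero hq0 m) x) h2
  push_cast at h
  linear_combination h

end NearFieldTheorem

theorem statement19 (q : ℝ) (hq0 : 0 < q) (hq1 : q < 1) (F : MonicOrthFamily q 1) :
    -- (a) near-field asymptotics
    (∃ (a : ℂ → ℂ) (C : ℝ),
      Differentiable ℂ a ∧ (∀ z : ℂ, a (-z) = a z) ∧ a 0 = 1 ∧
      (∀ z : ℂ,
        a ((q : ℂ)⁻¹ ^ 2 * z)
          + ((q : ℂ)⁻¹ ^ 3 * z ^ 2 * (1 + (q : ℂ)⁻¹) - (1 + (q : ℂ)⁻¹)) * a ((q : ℂ)⁻¹ * z)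
          + (q : ℂ)⁻¹ * (1 + (q : ℂ)⁻¹ ^ 4 * z ^ 4) * a z = 0) ∧
      C ≠ 0 ∧
      ∀ K : Set ℂ, IsCompact K → ∃ M : ℝ, 0 < M ∧
        ∀ n : ℕ, Even n → ∀ z ∈ K,
          ‖(-1 : ℂ) ^ (n / 2) * (q : ℂ) ^ ((n / 2) * (n / 2 - 1)) * Polynomial.aeval z (F.P n)
              - (C : ℂ) * a z‖
            ≤ M * q ^ ((n : ℝ) / 4)) ∧
    -- (b) far-field asymptotics
    (∃ ca : ℕ → ℂ,
      ca 0 = 1 ∧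
      (∀ t : ℂ, t ≠ 0 → Summable (fun j : ℕ => ca j * t⁻¹ ^ (2 * j))) ∧
      (∀ t : ℂ, t ≠ 0 →
        (q : ℂ) ^ 7 * t⁻¹ ^ 4 * (∑' j : ℕ, ca j * ((q : ℂ)⁻¹ ^ 2 * t)⁻¹ ^ (2 * j))
          - (1 - (q : ℂ) ^ 2 * ((q : ℂ) + 1) * t⁻¹ ^ 2) *
              (∑' j : ℕ, ca j * ((q : ℂ)⁻¹ * t)⁻¹ ^ (2 * j))
          + (∑' j : ℕ, ca j * t⁻¹ ^ (2 * j)) = 0) ∧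
      (∀ t : ℂ, t ≠ 0 → ∃ M : ℝ, 0 < M ∧ ∃ N : ℕ, ∀ n : ℕ, N ≤ n → Even n →
        ‖(q : ℂ) ^ (n * (n / 2)) * t⁻¹ ^ n
              * Polynomial.aeval (t * (q : ℂ) ^ (-((n / 2 : ℕ) : ℤ))) (F.P n)
            - (∑' j : ℕ, ca j * t⁻¹ ^ (2 * j))‖
          ≤ M * q ^ ((n : ℝ) / 4))) := by
  set ρ : ℝ := q ^ (1 / 4 : ℝ) with hρdef
  have hρ : 0 < ρ := Real.rpow_pos_of_pos hq0 _
  have hρ1 : ρ < 1 := Real.rpow_lt_one hq0.le hq1 (by norm_num)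
  have hq : q = ρ ^ 4 := by
    rw [hρdef, ← Real.rpow_natCast, ← Real.rpow_mul hq0.le]
    norm_num
  have hρn : ∀ n : ℕ, q ^ ((n : ℝ) / 4) = ρ ^ n := by
    intro n
    rw [hρdef, ← Real.rpow_natCast, ← Real.rpow_mul hq0.le]
    congr 1
    ring
  have hqC : (q : ℂ) ≠ 0 := by exact_mod_cast hq0.ne'
  have hσ1 : ρ ^ 2 < 1 := pow_lt_one₀ hρ.le hρ1 two_ne_zero
  have hσ : q = (ρ ^ 2) ^ 2 := by rw [← pow_mul, hq]
  refine ⟨?_, farCoef q, by simp [farCoef, vcoef_zero], fun t _ => ?_, fun t ht => ?_,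
    fun t ht => ?_⟩
  · obtain ⟨K, hK, hα⟩ := exists_alpha_bound hρ hρ1 hq hq0 hq1 F
    set S := F.toQFreudSystem hq0 hq1
    have ha : ∀ m, |q ^ (2 * m) * S.α (2 * m + 1) - 1| ≤ K * (ρ ^ 2) ^ m := by
      intro m
      rw [← pow_mul]
      exact hα _
    have hb : ∀ m, |q ^ (2 * (m + 1)) * S.α (2 * (m + 1)) - q| ≤ K * (ρ ^ 2) ^ m := by
      intro m
      rw [← pow_mul]
      have e : q ^ (2 * (m + 1)) * S.α (2 * (m + 1)) - q =
          q * (q ^ (2 * m + 1) * S.α (2 * m + 1 + 1) - 1) := by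
        rw [show 2 * (m + 1) = 2 * m + 1 + 1 by ring]
        ring
      rw [e, abs_mul, abs_of_pos hq0]
      calc _ ≤ 1 * (K * ρ ^ (2 * m)) := by
            gcongr
            refine (hα _).trans ?_
            gcongr K * ?_
            exact pow_le_pow_of_le_one hρ.le hρ1.le (Nat.le_succ _)
        _ = _ := one_mul _
    have hα1 : Filter.Tendsto (fun n => q ^ n * S.α (n + 1)) Filter.atTop (𝓝 1) := by
      rw [tendsto_iff_norm_sub_tendsto_zero]
      refine squeeze_zero (fun n => norm_nonneg _) hα ?_
      simpa using (tendsto_pow_atTop_nhds_zero_of_lt_one hρ.le hρ1).const_mul K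
    obtain ⟨R, c, hdiff, heven, hc, hR0, hlim, hbound⟩ :=
      S.exists_near_limit hq0 hσ (by positivity) hσ1 hK.le ha hb
    have hcC : (c : ℂ) ≠ 0 := by exact_mod_cast hc
    refine ⟨fun z => (c : ℂ)⁻¹ * R z, c, hdiff.const_mul _, fun z => by simp only [heven], ?_,
      fun z => ?_, hc, fun T hT => ?_⟩
    · simp only [hR0, inv_mul_cancel₀ hcC]
    · have h := S.near_limit_functional_eq hq0 hq1 hα1 hlim ((q : ℂ)⁻¹ * z)
      rw [mul_inv_cancel_left₀ hqC, ← mul_assoc, ← pow_two] at h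
      simp only
      linear_combination (c : ℂ)⁻¹ * h
    · obtain ⟨M, hM, h⟩ := hbound T hT
      refine ⟨M, hM, fun n hn z hz => ?_⟩
      obtain ⟨m, rfl⟩ := hn.two_dvd
      rw [Nat.mul_div_cancel_left m two_pos, mul_inv_cancel_left₀ hcC, hρn, pow_mul ρ]
      exact h m z hz
  · simp only [pow_mul]
    exact summable_farCoef hq0 hq1 _
  · have h := farSum_functional_eq hq0 hq1 (t⁻¹ ^ 2)
    have e1 : ((q : ℂ)⁻¹ ^ 2 * t)⁻¹ ^ 2 = q ^ 4 * t⁻¹ ^ 2 := by field_simp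
    have e2 : ((q : ℂ)⁻¹ * t)⁻¹ ^ 2 = q ^ 2 * t⁻¹ ^ 2 := by field_simp
    simp only [pow_mul _ 2, e1, e2]
    simp only [farSum, ← pow_mul] at h ⊢
    exact h
  · obtain ⟨M, hM, h⟩ := farField hρ hρ1 hq hq0 hq1 F t ht
    refine ⟨M, hM, 0, fun n _ hn => ?_⟩
    rw [hρn]
    simp only [pow_mul t⁻¹ 2]
    exact h n hn
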